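/- Let d = 2 and W = ½w² where w ∈ C²(ℝ²,ℝ) solves the Laplace equation ∂₁₁w + ∂₂₂w = 0 (respectively, the wave equation ∂₁₁w − ∂₂₂w = 0) in ℝ². Let u^± = (a,u₂^±) ∈ ℝ² be two wells of W (W(u^±) = 0) such that w > 0 on the open segment (u^-,u^+). If u is a global minimizer of problem (P) and either u ∈ L^∞(Ω,ℝ²) or W satisfies the growth condition W(z) ≤ C e^{β|z|²} for some C, β > 0, then u is one-dimensional: u(x) = g(x₁) where g is the unique minimizer (up to translation) of the one-dimensional problem. -/

import Mathlib

open MeasureTheory Filter Topology ENNReal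

noncomputable section

/-- Squared Euclidean norm on `ℝ^d` (modelled as `Fin d → ℝ`). -/
def vnorm2 {d : ℕ} (v : Fin d → ℝ) : ℝ := ∑ i, v i ^ 2

/-- Partial derivative in the `i`-th coordinate direction of a map `ℝ^d → ℝ^d`. -/
def pd {d : ℕ} (i : Fin d) (u : (Fin d → ℝ) → Fin d → ℝ) (x : Fin d → ℝ) : Fin d → ℝ :=
  fderiv ℝ u x (Pi.single i 1)

/-- Partial derivative in the `i`-th coordinate direction of a scalar function on `ℝ^d`. -/
def pdS {d : ℕ} (i : Fin d) (w : (Fin d → ℝ) → ℝ) (x : Fin d → ℝ) : ℝ :=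
  fderiv ℝ w x (Pi.single i 1)

/-- Squared Frobenius norm `|∇u|²` of the Jacobian of `u`. -/
def gradSq {d : ℕ} (u : (Fin d → ℝ) → Fin d → ℝ) (x : Fin d → ℝ) : ℝ :=
  ∑ i, ∑ j, (pd i u x j) ^ 2

/-- Divergence-free condition `∇ ⋅ u = 0`. -/
def IsDivFree {d : ℕ} (u : (Fin d → ℝ) → Fin d → ℝ) : Prop :=
  ∀ x, ∑ i, pd i u x i = 0

/-- Periodicity (period 1) in the last `d-1` coordinates: `u` is a map on `Ω = ℝ × 𝕋^{d-1}`. -/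
def IsPeriodic {d : ℕ} [NeZero d] (u : (Fin d → ℝ) → Fin d → ℝ) : Prop :=
  ∀ (x : Fin d → ℝ) (i : Fin d), i ≠ 0 → u (x + Pi.single i 1) = u x

/-- Fundamental domain `ℝ × [0,1)^{d-1}` of `Ω = ℝ × 𝕋^{d-1}`. -/
def strip (d : ℕ) [NeZero d] : Set (Fin d → ℝ) :=
  {x | ∀ i : Fin d, i ≠ 0 → x i ∈ Set.Ico (0 : ℝ) 1}

/-- The unit cube `[0,1)^d`. -/
def cube (d : ℕ) : Set (Fin d → ℝ) := Set.univ.pi fun _ => Set.Ico (0 : ℝ) 1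

/-- The `x'`-average `ū(t) = ∫_{𝕋^{d-1}} u(t,x') dx'`. -/
def avg {d : ℕ} [NeZero d] (u : (Fin d → ℝ) → Fin d → ℝ) (t : ℝ) : Fin d → ℝ :=
  ∫ y in cube d, u (Function.update y 0 t)

/-- Energy density `½|∇u|² + W(u)`. -/
def eden {d : ℕ} (W : (Fin d → ℝ) → ℝ) (u : (Fin d → ℝ) → Fin d → ℝ) (x : Fin d → ℝ) : ℝ :=
  (1 / 2) * gradSq u x + W (u x)

/-- Total energy `E(u)` on `Ω`, with values in `[0,∞]`. -/
def energy (d : ℕ) [NeZero d] (W : (Fin d → ℝ) → ℝ) (u : (Fin d → ℝ) → Fin d → ℝ) : ℝ≥0∞ :=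
  ∫⁻ x in strip d, ENNReal.ofReal (eden W u x)

/-- Membership in `Ḣ¹_div(Ω, ℝ^d)` (with classical derivatives). -/
def Adm (d : ℕ) [NeZero d] (u : (Fin d → ℝ) → Fin d → ℝ) : Prop :=
  Differentiable ℝ u ∧ IsPeriodic u ∧ IsDivFree u ∧ IntegrableOn (gradSq u) (strip d)

/-- The boundary conditions `ū(-∞) = u⁻`, `ū(+∞) = u⁺`. -/
def BdryCond (d : ℕ) [NeZero d] (u : (Fin d → ℝ) → Fin d → ℝ) (um up : Fin d → ℝ) : Prop :=
  Tendsto (avg u) atBot (𝓝 um) ∧ Tendsto (avg u) atTop (𝓝 up)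

/-- `S_a`: the zeros of `W` in the hyperplane `{z₁ = a}`. -/
def wellSet (d : ℕ) [NeZero d] (W : (Fin d → ℝ) → ℝ) (a : ℝ) : Set (Fin d → ℝ) :=
  {z | z 0 = a ∧ W z = 0}

/-- Hypothesis (H2): `liminf_{z₁ → a, |z'| → ∞} W(z₁,z') > 0`. -/
def H2cond (d : ℕ) [NeZero d] (W : (Fin d → ℝ) → ℝ) (a : ℝ) : Prop :=
  ∃ c > (0 : ℝ), ∃ δ > (0 : ℝ), ∃ R : ℝ, ∀ z : Fin d → ℝ,
    |z 0 - a| < δ → R ≤ ∑ i, (if i = (0 : Fin d) then 0 else z i ^ 2) → c ≤ W z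

/-- An admissible one-dimensional transition layer: a curve in the hyperplane `{z₁ = a}`
connecting `u⁻` (at `-∞`) to `u⁺` (at `+∞`). -/
def Adm1D (d : ℕ) [NeZero d] (a : ℝ) (um up : Fin d → ℝ) (γ : ℝ → Fin d → ℝ) : Prop :=
  Differentiable ℝ γ ∧ (∀ t, γ t 0 = a) ∧
  Tendsto γ atBot (𝓝 um) ∧ Tendsto γ atTop (𝓝 up)

/-- One-dimensional energy `∫_ℝ ½|γ̇|² + W(γ)`. -/
def energy1D (d : ℕ) (W : (Fin d → ℝ) → ℝ) (γ : ℝ → Fin d → ℝ) : ℝ≥0∞ :=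
  ∫⁻ t : ℝ, ENNReal.ofReal ((1 / 2) * vnorm2 (deriv γ t) + W (γ t))

/-- Geodesic (pseudo-)distance `geod^a_F(x,y)` in the hyperplane `{z₁ = a}` for the degenerate
metric `2 F g₀`: infimum of `∫_{-1}^{1} √(2F(γ)) |γ̇| dt` over Lipschitz curves in the
hyperplane joining `x` to `y`. -/
def geodA (d : ℕ) [NeZero d] (F : (Fin d → ℝ) → ℝ) (a : ℝ) (x y : Fin d → ℝ) : ℝ :=
  sInf {L | ∃ γ : ℝ → Fin d → ℝ, (∃ K : NNReal, LipschitzWith K γ) ∧ (∀ t, γ t 0 = a) ∧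
    γ (-1) = x ∧ γ 1 = y ∧
    L = ∫ t in Set.Icc (-1 : ℝ) 1, Real.sqrt (2 * F (γ t)) * Real.sqrt (vnorm2 (deriv γ t))}

/-- Derivative of a function on the plane in the first coordinate direction. -/
def dx (F : ℝ × ℝ → ℝ) (z : ℝ × ℝ) : ℝ := fderiv ℝ F z (1, 0)

/-- Derivative of a function on the plane in the second coordinate direction. -/
def dy (F : ℝ × ℝ → ℝ) (z : ℝ × ℝ) : ℝ := fderiv ℝ F z (0, 1)

/-- Lebesgue measure on the periodicity cell `(0,1]`. -/
def cellMeasure : Measure ℝ := volume.restrict (Set.Ioc 0 1)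

/-- Lebesgue measure on the rectangle `(s,t] × (0,1]`. -/
def boxMeasure (s t : ℝ) : Measure (ℝ × ℝ) :=
  (volume.restrict (Set.Ioc s t)).prod cellMeasure

instance : IsProbabilityMeasure cellMeasure := ⟨by simp [cellMeasure]⟩

instance (s t : ℝ) : IsFiniteMeasure (boxMeasure s t) := by
  unfold boxMeasure; infer_instance

theorem boxMeasure_eq (s t : ℝ) :
    boxMeasure s t = volume.restrict (Set.Ioc s t ×ˢ Set.Ioc 0 1) := by
  rw [boxMeasure, cellMeasure, Measure.prod_restrict, Measure.volume_eq_prod]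

theorem boxMeasure_le_strip (s t : ℝ) :
    boxMeasure s t ≤ (volume : Measure ℝ).prod cellMeasure := by
  have h : (volume : Measure ℝ).prod cellMeasure
      = volume.restrict (Set.univ ×ˢ Set.Ioc 0 1) := by
    rw [cellMeasure, Measure.volume_eq_prod, ← Measure.prod_restrict, Measure.restrict_univ]
  rw [h, boxMeasure_eq]
  exact Measure.restrict_mono (Set.prod_mono (Set.subset_univ _) le_rfl) le_rfl

theorem ae_boxMeasure_mem (s t : ℝ) :
    ∀ᵐ z ∂boxMeasure s t, z ∈ Set.Icc s t ×ˢ Set.Icc (0 : ℝ) 1 := by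
  rw [boxMeasure_eq]
  filter_upwards [ae_restrict_mem (measurableSet_Ioc.prod measurableSet_Ioc)] with z hz
  exact ⟨Set.Ioc_subset_Icc_self hz.1, Set.Ioc_subset_Icc_self hz.2⟩

theorem measurable_dx (F : ℝ × ℝ → ℝ) : Measurable (dx F) := measurable_fderiv_apply_const ..

theorem measurable_dy (F : ℝ × ℝ → ℝ) : Measurable (dy F) := measurable_fderiv_apply_const ..

theorem hasDerivAt_slice_fst {F : ℝ × ℝ → ℝ} (hF : Differentiable ℝ F) (x y : ℝ) :
    HasDerivAt (fun s => F (s, y)) (dx F (x, y)) x :=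
  (hF (x, y)).hasFDerivAt.comp_hasDerivAt (f := fun s : ℝ => (s, y)) x
    ((hasDerivAt_id x).prodMk (hasDerivAt_const x y))

theorem hasDerivAt_slice_snd {F : ℝ × ℝ → ℝ} (hF : Differentiable ℝ F) (x y : ℝ) :
    HasDerivAt (fun s => F (x, s)) (dy F (x, y)) y :=
  (hF (x, y)).hasFDerivAt.comp_hasDerivAt (f := fun s : ℝ => (x, s)) y
    ((hasDerivAt_const y x).prodMk (hasDerivAt_id y))

/-- `1`-periodicity in the second variable. -/
def PeriodicSnd (F : ℝ × ℝ → ℝ) : Prop := ∀ x y, F (x, y + 1) = F (x, y)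

theorem fderiv_add_period {F : ℝ × ℝ → ℝ} (hF : PeriodicSnd F) (x y : ℝ) :
    fderiv ℝ F (x, y + 1) = fderiv ℝ F (x, y) := by
  have h : (fun z : ℝ × ℝ => F (z + (0, 1))) = F := by
    funext ⟨a, b⟩
    simpa using hF a b
  have := fderiv_comp_add_right (𝕜 := ℝ) (f := F) (x := (x, y)) ((0 : ℝ), (1 : ℝ))
  rw [h] at this
  simpa using this.symm

theorem PeriodicSnd.dx {F : ℝ × ℝ → ℝ} (hF : PeriodicSnd F) : PeriodicSnd (dx F) := fun x y => by
  simp only [_root_.dx, fderiv_add_period hF]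

theorem PeriodicSnd.dy {F : ℝ × ℝ → ℝ} (hF : PeriodicSnd F) : PeriodicSnd (dy F) := fun x y => by
  simp only [_root_.dy, fderiv_add_period hF]

theorem integral_dx {F : ℝ × ℝ → ℝ} (hF : Differentiable ℝ F) {s t : ℝ} (hst : s ≤ t)
    (hi : Integrable (dx F) (boxMeasure s t)) :
    ∫ z, dx F z ∂boxMeasure s t = ∫ y, (F (t, y) - F (s, y)) ∂cellMeasure := by
  unfold boxMeasure at hi ⊢
  rw [integral_prod_symm _ hi]
  refine integral_congr_ae ?_
  filter_upwards [hi.prod_left_ae] with y hy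
  rw [← intervalIntegral.integral_of_le hst]
  exact intervalIntegral.integral_eq_sub_of_hasDerivAt
    (fun x _ => hasDerivAt_slice_fst hF x y) ((intervalIntegrable_iff_integrableOn_Ioc_of_le hst).2 hy)

theorem integral_dy {F : ℝ × ℝ → ℝ} (hF : Differentiable ℝ F) (hp : PeriodicSnd F) {s t : ℝ}
    (hi : Integrable (dy F) (boxMeasure s t)) :
    ∫ z, dy F z ∂boxMeasure s t = 0 := by
  unfold boxMeasure at hi ⊢
  rw [integral_prod _ hi]
  refine integral_eq_zero_of_ae ?_
  filter_upwards [hi.prod_right_ae] with x hx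
  rw [cellMeasure, ← intervalIntegral.integral_of_le zero_le_one,
    intervalIntegral.integral_eq_sub_of_hasDerivAt (f := fun y => F (x, y))
    (fun y _ => hasDerivAt_slice_snd hF x y)
    ((intervalIntegrable_iff_integrableOn_Ioc_of_le zero_le_one).2 hx)]
  have := hp x 0
  simp only [zero_add] at this
  simp [this]

theorem MemLp.continuous_mul {c F : ℝ × ℝ → ℝ} (hc : Continuous c) {s t : ℝ}
    (hF : MemLp F 2 (boxMeasure s t)) : MemLp (fun z => c z * F z) 2 (boxMeasure s t) := by
  obtain ⟨C, hC⟩ := (isCompact_Icc.prod isCompact_Icc :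
    IsCompact (Set.Icc s t ×ˢ Set.Icc (0 : ℝ) 1)).exists_bound_of_continuousOn hc.continuousOn
  refine hF.of_le_mul (c := C) (hc.aestronglyMeasurable.mul hF.1) ?_
  filter_upwards [ae_boxMeasure_mem s t] with z hz
  rw [norm_mul]
  exact mul_le_mul_of_nonneg_right (hC z hz) (norm_nonneg _)

theorem Continuous.memLp_box {c : ℝ × ℝ → ℝ} (hc : Continuous c) {s t : ℝ} :
    MemLp c 2 (boxMeasure s t) := by
  simpa using MemLp.continuous_mul hc (memLp_const (1 : ℝ) (μ := boxMeasure s t))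

/-- Cauchy–Schwarz for real functions. -/
theorem sq_integral_mul_le {α : Type*} [MeasurableSpace α] {μ : Measure α} {f g : α → ℝ}
    (hf : MemLp f 2 μ) (hg : MemLp g 2 μ) :
    (∫ x, f x * g x ∂μ) ^ 2 ≤ (∫ x, f x ^ 2 ∂μ) * ∫ x, g x ^ 2 ∂μ := by
  have key : ∀ r : ℝ, 0 ≤ (∫ x, g x ^ 2 ∂μ) * (r * r) + (2 * ∫ x, f x * g x ∂μ) * r
      + ∫ x, f x ^ 2 ∂μ := by
    intro r
    have h : ∫ x, (f x + r * g x) ^ 2 ∂μ = (∫ x, g x ^ 2 ∂μ) * (r * r)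
        + (2 * ∫ x, f x * g x ∂μ) * r + ∫ x, f x ^ 2 ∂μ := by
      have h1 : ∀ x, (f x + r * g x) ^ 2 = r * r * g x ^ 2 + (2 * r) * (f x * g x) + f x ^ 2 :=
        fun x => by ring
      have hg2 := hg.integrable_sq.const_mul (r * r)
      have hfg : Integrable (fun x => f x * g x) μ := hf.integrable_mul hg
      have hadd : Integrable (fun x => r * r * g x ^ 2 + (2 * r) * (f x * g x)) μ :=
        hg2.add (hfg.const_mul _)
      simp only [h1]
      rw [integral_add hadd hf.integrable_sq,
        integral_add hg2 (hfg.const_mul _), integral_const_mul, integral_const_mul]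
      ring
    rw [← h]
    exact integral_nonneg fun x => sq_nonneg _
  have := discrim_le_zero key
  rw [discrim] at this
  linarith

/-- A function with an everywhere defined derivative which is a.e. equal to a continuous function
satisfies the equation everywhere, provided its derivative is locally integrable. -/
theorem hasDerivAt_of_ae_eq {k k' c : ℝ → ℝ} (hk : ∀ t, HasDerivAt k (k' t) t) (hc : Continuous c)
    (hae : ∀ᵐ t, k' t = c t) (t : ℝ) : HasDerivAt k (c t) t := by
  have h : ∀ x, k x = k 0 + ∫ s in (0 : ℝ)..x, c s := by
    intro x
    have hi : IntervalIntegrable k' volume 0 x :=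
      (hc.intervalIntegrable 0 x).congr_ae (ae_restrict_of_ae (hae.mono fun _ h => h.symm))
    have h1 := intervalIntegral.integral_eq_sub_of_hasDerivAt (fun s _ => hk s) hi
    have h2 : ∫ s in (0 : ℝ)..x, k' s = ∫ s in (0 : ℝ)..x, c s :=
      intervalIntegral.integral_congr_ae (hae.mono fun _ h _ => h)
    linarith
  have h' : k = fun x => k 0 + ∫ s in (0 : ℝ)..x, c s := funext h
  rw [h']
  exact (intervalIntegral.integral_hasDerivAt_right (hc.intervalIntegrable 0 t)
    (hc.stronglyMeasurableAtFilter _ _) hc.continuousAt).const_add _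

theorem lintegral_cell_shift {φ : ℝ → ℝ≥0∞} (hp : ∀ y, φ (y + 1) = φ y) (h : ℝ) :
    ∫⁻ y, φ (y + h) ∂cellMeasure = ∫⁻ y, φ y ∂cellMeasure := by
  have h1 : ∫⁻ y, φ (y + h) ∂cellMeasure = ∫⁻ y in Set.Ioc h (h + 1), φ y := by
    have he : MeasurableEmbedding (fun y : ℝ => y + h) := measurableEmbedding_addRight h
    have hpre : (fun y : ℝ => y + h) ⁻¹' Set.Ioc h (h + 1) = Set.Ioc 0 1 := by
      ext y; simp [add_comm]
    have := (measurePreserving_add_right volume h).setLIntegral_comp_preimage_emb he φ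
      (Set.Ioc h (h + 1))
    rwa [hpre] at this
  rw [h1, cellMeasure]
  have hd := (isAddFundamentalDomain_Ioc one_pos h).setLIntegral_eq
    (isAddFundamentalDomain_Ioc one_pos 0) φ (by
      rintro ⟨g, hg⟩ x
      obtain ⟨n, rfl⟩ := AddSubgroup.mem_zmultiples_iff.1 hg
      have hper : Function.Periodic φ 1 := hp
      simpa [add_comm] using hper.int_mul n x)
  simpa using hd

theorem lintegral_box_shift {φ : ℝ × ℝ → ℝ≥0∞} (hφ : Measurable φ)
    (hp : ∀ x y, φ (x, y + 1) = φ (x, y)) (s t h : ℝ) :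
    ∫⁻ z, φ (z.1, z.2 + h) ∂boxMeasure s t = ∫⁻ z, φ z ∂boxMeasure s t := by
  unfold boxMeasure
  rw [lintegral_prod _ (by fun_prop), lintegral_prod _ hφ.aemeasurable]
  exact lintegral_congr fun x => lintegral_cell_shift (φ := fun y => φ (x, y)) (hp x) h

/-- Translation in the periodic variable preserves the rectangle integral. -/
theorem map_shift_box {K : ℝ × ℝ → ℝ} (hK : Measurable K) (hp : PeriodicSnd K) {s t : ℝ}
    (hi : Integrable K (boxMeasure s t)) (h : ℝ) :
    Integrable (fun z : ℝ × ℝ => K (z.1, z.2 + h)) (boxMeasure s t) ∧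
      ∫ z, K (z.1, z.2 + h) ∂boxMeasure s t = ∫ z, K z ∂boxMeasure s t := by
  have hi' : Integrable (fun z : ℝ × ℝ => K (z.1, z.2 + h)) (boxMeasure s t) := by
    refine ⟨(by fun_prop : Measurable fun z : ℝ × ℝ => K (z.1, z.2 + h)).aestronglyMeasurable, ?_⟩
    have := lintegral_box_shift (φ := fun z => ‖K z‖ₑ) (by fun_prop)
      (fun x y => by simp only [hp x y]) s t h
    rw [HasFiniteIntegral, this]
    exact hi.2
  refine ⟨hi', ?_⟩
  rw [integral_eq_lintegral_pos_part_sub_lintegral_neg_part hi',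
    integral_eq_lintegral_pos_part_sub_lintegral_neg_part hi,
    lintegral_box_shift (φ := fun z => ENNReal.ofReal (K z)) (by fun_prop)
      (fun x y => by simp only [hp x y]),
    lintegral_box_shift (φ := fun z => ENNReal.ofReal (-K z)) (by fun_prop)
      (fun x y => by simp only [hp x y])]

theorem MemLp.shift {K : ℝ × ℝ → ℝ} (hK : Measurable K) (hp : PeriodicSnd K) {s t : ℝ}
    (hi : MemLp K 2 (boxMeasure s t)) (h : ℝ) :
    MemLp (fun z : ℝ × ℝ => K (z.1, z.2 + h)) 2 (boxMeasure s t) := by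
  rw [memLp_two_iff_integrable_sq
    (by fun_prop : Measurable fun z : ℝ × ℝ => K (z.1, z.2 + h)).aestronglyMeasurable]
  exact (map_shift_box (K := fun z => K z ^ 2) (by fun_prop) (fun x y => by simp only [hp x y])
    hi.integrable_sq h).1

theorem ofReal_sq_sub_le {k k' : ℝ → ℝ} (hk : ∀ y, HasDerivAt k (k' y) y) (y : ℝ) {h : ℝ}
    (hh : 0 < h) :
    ENNReal.ofReal ((k (y + h) - k y) ^ 2) ≤
      ENNReal.ofReal h * ∫⁻ s in Set.Ioc 0 h, ENNReal.ofReal (k' (y + s) ^ 2) := by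
  have hk'm : Measurable k' := by
    have : k' = deriv k := funext fun y => (hk y).deriv.symm
    rw [this]; exact measurable_deriv k
  by_cases hfin : ∫⁻ s in Set.Ioc 0 h, ENNReal.ofReal (k' (y + s) ^ 2) = ∞
  · rw [hfin, ENNReal.mul_top (by simpa using hh)]
    exact le_top
  have hm : Measurable fun s => k' (y + s) := by fun_prop
  have h_int : Integrable (fun s => k' (y + s) ^ 2) (volume.restrict (Set.Ioc 0 h)) := by
    refine ⟨(hm.pow_const 2).aestronglyMeasurable, ?_⟩
    rw [hasFiniteIntegral_iff_ofReal (Eventually.of_forall fun _ => sq_nonneg _)]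
    exact lt_top_iff_ne_top.2 hfin
  have hL : MemLp (fun s => k' (y + s)) 2 (volume.restrict (Set.Ioc 0 h)) :=
    (memLp_two_iff_integrable_sq hm.aestronglyMeasurable).2 h_int
  have hFTC : ∫ s in Set.Ioc 0 h, k' (y + s) = k (y + h) - k y := by
    rw [← intervalIntegral.integral_of_le hh.le]
    have := intervalIntegral.integral_eq_sub_of_hasDerivAt (a := 0) (b := h)
      (f := fun s => k (y + s)) (f' := fun s => k' (y + s))
      (fun s _ => (hk (y + s)).comp_const_add y s)
      ((intervalIntegrable_iff_integrableOn_Ioc_of_le hh.le).2 (hL.integrable one_le_two))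
    simpa using this
  have hCS := sq_integral_mul_le hL (memLp_const (1 : ℝ))
  simp only [mul_one, hFTC, one_pow, integral_const, smul_eq_mul, measureReal_restrict_apply_univ,
    Real.volume_real_Ioc_of_le hh.le, sub_zero] at hCS
  rw [← ofReal_integral_eq_lintegral_ofReal h_int (Eventually.of_forall fun _ => sq_nonneg _),
    ← ENNReal.ofReal_mul hh.le]
  exact ENNReal.ofReal_le_ofReal (by linarith)

theorem lintegral_cell_sq_sub_le {k k' : ℝ → ℝ} (hk : ∀ y, HasDerivAt k (k' y) y)
    (hp : ∀ y, k' (y + 1) = k' y) {h : ℝ} (hh : 0 < h) :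
    ∫⁻ y, ENNReal.ofReal ((k (y + h) - k y) ^ 2) ∂cellMeasure ≤
      ENNReal.ofReal (h ^ 2) * ∫⁻ y, ENNReal.ofReal (k' y ^ 2) ∂cellMeasure := by
  have hk'm : Measurable k' := by
    have : k' = deriv k := funext fun y => (hk y).deriv.symm
    rw [this]; exact measurable_deriv k
  calc ∫⁻ y, ENNReal.ofReal ((k (y + h) - k y) ^ 2) ∂cellMeasure
      ≤ ∫⁻ y, (ENNReal.ofReal h * ∫⁻ s in Set.Ioc 0 h, ENNReal.ofReal (k' (y + s) ^ 2))
          ∂cellMeasure := lintegral_mono fun y => ofReal_sq_sub_le hk y hh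
    _ = ENNReal.ofReal h * ∫⁻ s in Set.Ioc 0 h, ∫⁻ y, ENNReal.ofReal (k' (y + s) ^ 2)
          ∂cellMeasure := by
        rw [lintegral_const_mul' _ _ ENNReal.ofReal_ne_top, lintegral_lintegral_swap]
        exact (by fun_prop : Measurable fun z : ℝ × ℝ =>
          ENNReal.ofReal (k' (z.1 + z.2) ^ 2)).aemeasurable
    _ = ENNReal.ofReal h * ∫⁻ _ in Set.Ioc 0 h, ∫⁻ y, ENNReal.ofReal (k' y ^ 2)
          ∂cellMeasure := by
        simp only [lintegral_cell_shift (φ := fun y => ENNReal.ofReal (k' y ^ 2))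
          (fun y => by simp only [hp y])]
    _ = _ := by
        rw [lintegral_const, Measure.restrict_apply_univ, Real.volume_Ioc, sub_zero, pow_two,
          ENNReal.ofReal_mul hh.le]
        ring

theorem lintegral_cell_diffQuot_sq_le {k k' : ℝ → ℝ} (hk : ∀ y, HasDerivAt k (k' y) y)
    (hp : ∀ y, k' (y + 1) = k' y) {h : ℝ} (hh : 0 < h) :
    ∫⁻ y, ENNReal.ofReal (((k (y + h) - k y) / h) ^ 2) ∂cellMeasure ≤
      ∫⁻ y, ENNReal.ofReal (k' y ^ 2) ∂cellMeasure := by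
  have h0 : ENNReal.ofReal (h ^ 2) ≠ 0 := by simpa using hh.ne'
  have h2 : ∀ y, ENNReal.ofReal (((k (y + h) - k y) / h) ^ 2)
      = (ENNReal.ofReal (h ^ 2))⁻¹ * ENNReal.ofReal ((k (y + h) - k y) ^ 2) := by
    intro y
    rw [div_pow, div_eq_inv_mul, ENNReal.ofReal_mul (by positivity),
      ENNReal.ofReal_inv_of_pos (by positivity)]
  simp only [h2]
  rw [lintegral_const_mul' _ _ (by simpa using h0)]
  calc _ ≤ (ENNReal.ofReal (h ^ 2))⁻¹ * (ENNReal.ofReal (h ^ 2) *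
        ∫⁻ y, ENNReal.ofReal (k' y ^ 2) ∂cellMeasure) := by
        gcongr
        exact lintegral_cell_sq_sub_le hk hp hh
    _ = _ := by rw [← mul_assoc, ENNReal.inv_mul_cancel h0 ENNReal.ofReal_ne_top, one_mul]

/-- Difference quotients in the periodic variable are bounded in `L²` by the derivative. -/
theorem lintegral_diffQuot_sq_le {g : ℝ × ℝ → ℝ} (hg : Differentiable ℝ g) (hp : PeriodicSnd g)
    (s t : ℝ) {h : ℝ} (hh : 0 < h) :
    ∫⁻ z, ENNReal.ofReal (((g (z.1, z.2 + h) - g z) / h) ^ 2) ∂boxMeasure s t ≤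
      ∫⁻ z, ENNReal.ofReal (dy g z ^ 2) ∂boxMeasure s t := by
  have hgm := hg.continuous.measurable
  have hdm := measurable_dy g
  unfold boxMeasure
  rw [lintegral_prod _ (by fun_prop), lintegral_prod _ (by fun_prop)]
  exact lintegral_mono fun x =>
    lintegral_cell_diffQuot_sq_le (hasDerivAt_slice_snd hg x) (hp.dy x) hh

/-- If `φₙ → φ` a.e. and the `L²` norms of `φₙ` do not exceed the one of `φ`, then
`∫ F φₙ → ∫ F φ` for every `F ∈ L²`. -/
theorem tendsto_integral_mul_of_sq_le {α : Type*} [MeasurableSpace α] {μ : Measure α}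
    {F φ : α → ℝ} {φn : ℕ → α → ℝ} (hF : MemLp F 2 μ) (hφ : MemLp φ 2 μ)
    (hn : ∀ n, Measurable (φn n)) (hφm : Measurable φ)
    (hle : ∀ n, ∫⁻ x, ENNReal.ofReal (φn n x ^ 2) ∂μ ≤ ∫⁻ x, ENNReal.ofReal (φ x ^ 2) ∂μ)
    (hlim : ∀ x, Tendsto (fun n => φn n x) atTop (𝓝 (φ x))) :
    Tendsto (fun n => ∫ x, F x * φn n x ∂μ) atTop (𝓝 (∫ x, F x * φ x ∂μ)) := by
  have hnn : ∀ ψ : α → ℝ, ∀ᵐ x ∂μ, 0 ≤ ψ x ^ 2 := fun ψ => Eventually.of_forall fun _ => sq_nonneg _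
  have hφi := hφ.integrable_sq
  have hfin : ∫⁻ x, ENNReal.ofReal (φ x ^ 2) ∂μ < ∞ :=
    (hasFiniteIntegral_iff_ofReal (hnn φ)).1 hφi.2
  have hφni : ∀ n, Integrable (fun x => φn n x ^ 2) μ := fun n =>
    ⟨((hn n).pow_const 2).aestronglyMeasurable,
      (hasFiniteIntegral_iff_ofReal (hnn _)).2 ((hle n).trans_lt hfin)⟩
  have hφnL : ∀ n, MemLp (φn n) 2 μ := fun n =>
    (memLp_two_iff_integrable_sq (hn n).aestronglyMeasurable).2 (hφni n)
  have hdL : ∀ n, MemLp (fun x => φn n x - φ x) 2 μ := fun n => (hφnL n).sub hφ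
  have hint_le : ∀ n, ∫ x, φn n x ^ 2 ∂μ ≤ ∫ x, φ x ^ 2 ∂μ := fun n => by
    rw [integral_eq_lintegral_of_nonneg_ae (hnn _) (hφni n).1,
      integral_eq_lintegral_of_nonneg_ae (hnn _) hφi.1]
    exact ENNReal.toReal_mono hfin.ne (hle n)
  set A := ∫ x, φ x ^ 2 ∂μ with hA
  set d : ℕ → ℝ := fun n => ∫ x, (φn n x - φ x) ^ 2 ∂μ with hd
  have hd0 : ∀ n, 0 ≤ d n := fun n => integral_nonneg fun _ => sq_nonneg _
  have hQ : ∀ n, Integrable (fun x => 2 * φn n x ^ 2 + 2 * φ x ^ 2 - (φn n x - φ x) ^ 2) μ :=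
    fun n => (((hφni n).const_mul 2).add (hφi.const_mul 2)).sub (hdL n).integrable_sq
  have hQ0 : ∀ n x, 0 ≤ 2 * φn n x ^ 2 + 2 * φ x ^ 2 - (φn n x - φ x) ^ 2 := fun n x => by
    nlinarith [sq_nonneg (φn n x + φ x)]
  have hQint : ∀ n, ∫ x, (2 * φn n x ^ 2 + 2 * φ x ^ 2 - (φn n x - φ x) ^ 2) ∂μ ≤ 4 * A - d n := by
    intro n
    have hadd : Integrable (fun x => 2 * φn n x ^ 2 + 2 * φ x ^ 2) μ :=
      ((hφni n).const_mul 2).add (hφi.const_mul 2)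
    rw [integral_sub hadd (hdL n).integrable_sq,
      integral_add ((hφni n).const_mul 2) (hφi.const_mul 2), integral_const_mul, integral_const_mul]
    linarith [hint_le n]
  have hfatou : ENNReal.ofReal (4 * A) ≤ liminf (fun n => ENNReal.ofReal (4 * A - d n)) atTop := by
    calc ENNReal.ofReal (4 * A) = ∫⁻ x, ENNReal.ofReal (4 * φ x ^ 2) ∂μ := by
          rw [hA, ← integral_const_mul, ofReal_integral_eq_lintegral_ofReal (hφi.const_mul 4)
            (Eventually.of_forall fun _ => by positivity)]
      _ = ∫⁻ x, liminf (fun n => ENNReal.ofReal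
            (2 * φn n x ^ 2 + 2 * φ x ^ 2 - (φn n x - φ x) ^ 2)) atTop ∂μ := by
          refine lintegral_congr fun x => (Tendsto.liminf_eq ?_).symm
          refine ENNReal.tendsto_ofReal ?_
          have := ((((hlim x).pow 2).const_mul 2).add_const (2 * φ x ^ 2)).sub
            (((hlim x).sub_const (φ x)).pow 2)
          convert this using 2
          ring
      _ ≤ liminf (fun n => ∫⁻ x, ENNReal.ofReal
            (2 * φn n x ^ 2 + 2 * φ x ^ 2 - (φn n x - φ x) ^ 2) ∂μ) atTop :=
          lintegral_liminf_le fun n => by have := hn n; fun_prop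
      _ ≤ _ := by
          refine liminf_le_liminf (Eventually.of_forall fun n => ?_)
          rw [← ofReal_integral_eq_lintegral_ofReal (hQ n) (Eventually.of_forall (hQ0 n))]
          exact ENNReal.ofReal_le_ofReal (hQint n)
  have hA0 : 0 ≤ A := integral_nonneg fun _ => sq_nonneg _
  have hdlim : Tendsto d atTop (𝓝 0) := by
    rw [Metric.tendsto_atTop]
    intro ε hε
    rcases hA0.eq_or_lt with hA0 | hApos
    · refine ⟨0, fun n _ => ?_⟩
      have : d n ≤ 0 := by
        have := (integral_nonneg (hQ0 n)).trans (hQint n)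
        linarith
      rw [Real.dist_eq, sub_zero, abs_of_nonneg (hd0 n)]
      linarith
    · have hlt : ENNReal.ofReal (4 * A - ε) < liminf (fun n => ENNReal.ofReal (4 * A - d n)) atTop :=
        ((ENNReal.ofReal_lt_ofReal_iff (by linarith)).2 (by linarith)).trans_le hfatou
      obtain ⟨N, hN⟩ := eventually_atTop.1 (eventually_lt_of_lt_liminf hlt)
      refine ⟨N, fun n hNn => ?_⟩
      have := lt_of_not_ge fun h => (hN n hNn).not_ge (ENNReal.ofReal_le_ofReal h)
      rw [Real.dist_eq, sub_zero, abs_of_nonneg (hd0 n)]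
      linarith
  have hsq : Tendsto (fun n => (∫ x, F x * (φn n x - φ x) ∂μ) ^ 2) atTop (𝓝 0) := by
    refine squeeze_zero (fun _ => sq_nonneg _) (fun n => sq_integral_mul_le hF (hdL n)) ?_
    simpa using hdlim.const_mul (∫ x, F x ^ 2 ∂μ)
  have hz : Tendsto (fun n => ∫ x, F x * (φn n x - φ x) ∂μ) atTop (𝓝 0) := by
    have h1 := (Real.continuous_sqrt.tendsto 0).comp hsq
    simp only [Function.comp_def, Real.sqrt_sq_eq_abs, Real.sqrt_zero] at h1
    exact (tendsto_zero_iff_abs_tendsto_zero _).2 h1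
  have heq : ∀ n, ∫ x, F x * φn n x ∂μ = ∫ x, F x * (φn n x - φ x) ∂μ + ∫ x, F x * φ x ∂μ := by
    intro n
    have i1 : Integrable (fun x => F x * (φn n x - φ x)) μ := hF.integrable_mul (hdL n)
    have i2 : Integrable (fun x => F x * φ x) μ := hF.integrable_mul hφ
    rw [← integral_add i1 i2]
    exact integral_congr_ae (Eventually.of_forall fun x => by ring)
  simp only [heq]
  simpa using hz.add_const (∫ x, F x * φ x ∂μ)

/-- Translation in the second variable. -/
def shiftSnd (h : ℝ) (F : ℝ × ℝ → ℝ) (z : ℝ × ℝ) : ℝ := F (z.1, z.2 + h)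

theorem Differentiable.shiftSnd {F : ℝ × ℝ → ℝ} (hF : Differentiable ℝ F) (h : ℝ) :
    Differentiable ℝ (shiftSnd h F) := by
  unfold _root_.shiftSnd
  exact hF.comp (by fun_prop)

theorem dx_shiftSnd (h : ℝ) (F : ℝ × ℝ → ℝ) : dx (shiftSnd h F) = shiftSnd h (dx F) := by
  funext z
  have h1 : shiftSnd h F = fun z => F (z + (0, h)) := by
    funext ⟨a, b⟩; simp [shiftSnd]
  have := fderiv_comp_add_right (𝕜 := ℝ) (f := F) (x := z) ((0 : ℝ), h)
  obtain ⟨a, b⟩ := z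
  simp only [dx, h1, this]
  simp [shiftSnd, dx]

theorem PeriodicSnd.shiftSnd {F : ℝ × ℝ → ℝ} (hF : PeriodicSnd F) (h : ℝ) :
    PeriodicSnd (shiftSnd h F) := fun x y => by
  have := hF x (y + h)
  simp only [_root_.shiftSnd]
  rw [← this]; ring_nf

theorem dx_mul {F G : ℝ × ℝ → ℝ} (hF : Differentiable ℝ F) (hG : Differentiable ℝ G) (z : ℝ × ℝ) :
    dx (fun z => F z * G z) z = dx F z * G z + F z * dx G z := by
  simp only [dx]
  rw [fderiv_fun_mul (hF z) (hG z)]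
  simp; ring

theorem dy_mul {F G : ℝ × ℝ → ℝ} (hF : Differentiable ℝ F) (hG : Differentiable ℝ G) (z : ℝ × ℝ) :
    dy (fun z => F z * G z) z = dy F z * G z + F z * dy G z := by
  simp only [dy]
  rw [fderiv_fun_mul (hF z) (hG z)]
  simp; ring

/-- Forward difference quotient in the second variable. -/
def diffQuot (h : ℝ) (F : ℝ × ℝ → ℝ) (z : ℝ × ℝ) : ℝ := (shiftSnd h F z - F z) / h

theorem Differentiable.diffQuot {F : ℝ × ℝ → ℝ} (hF : Differentiable ℝ F) (h : ℝ) :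
    Differentiable ℝ (diffQuot h F) := by
  have h1 : _root_.diffQuot h F = fun z => h⁻¹ * (_root_.shiftSnd h F - F) z := by
    funext z
    simp [_root_.diffQuot, div_eq_inv_mul]
  rw [h1]
  exact ((hF.shiftSnd h).sub hF).const_mul h⁻¹

theorem dx_diffQuot {F : ℝ × ℝ → ℝ} (hF : Differentiable ℝ F) (h : ℝ) (z : ℝ × ℝ) :
    dx (diffQuot h F) z = (shiftSnd h (dx F) z - dx F z) / h := by
  have h1 : HasFDerivAt (diffQuot h F) (h⁻¹ • (fderiv ℝ (shiftSnd h F) z - fderiv ℝ F z)) z := by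
    have := (((hF.shiftSnd h) z).hasFDerivAt.sub (hF z).hasFDerivAt).const_mul h⁻¹
    have h1 : diffQuot h F = fun z => h⁻¹ * (shiftSnd h F - F) z := by
      funext z
      simp [diffQuot, div_eq_inv_mul]
    rwa [h1]
  rw [← dx_shiftSnd, dx, h1.fderiv]
  simp [dx, div_eq_inv_mul]

theorem abs_integral_mul_le_of_lintegral_sq {f D : ℝ → ℝ} (hf : Continuous f) (hD : Continuous D)
    {C δ : ℝ} (hδ : 0 ≤ δ) (hC : ∀ y, |f y| ≤ C)
    (hDδ : ∫⁻ y, ENNReal.ofReal (D y ^ 2) ∂cellMeasure ≤ ENNReal.ofReal (δ ^ 2)) :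
    |∫ y, f y * D y ∂cellMeasure| ≤ C * δ := by
  have hnn : ∀ ψ : ℝ → ℝ, ∀ᵐ y ∂cellMeasure, 0 ≤ ψ y ^ 2 :=
    fun ψ => Eventually.of_forall fun _ => sq_nonneg _
  have hC0 : 0 ≤ C := (abs_nonneg _).trans (hC 0)
  have hDi : Integrable (fun y => D y ^ 2) cellMeasure :=
    ⟨(hD.pow 2).aestronglyMeasurable, (hasFiniteIntegral_iff_ofReal (hnn _)).2
      (hDδ.trans_lt ofReal_lt_top)⟩
  have hDL : MemLp D 2 cellMeasure := (memLp_two_iff_integrable_sq hD.aestronglyMeasurable).2 hDi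
  have hfL : MemLp f 2 cellMeasure := MemLp.of_bound hf.aestronglyMeasurable C
    (Eventually.of_forall hC)
  have h1 := sq_integral_mul_le hfL hDL
  have h2 : ∫ y, f y ^ 2 ∂cellMeasure ≤ C ^ 2 := by
    have := integral_mono hfL.integrable_sq (integrable_const (C ^ 2))
      fun y => sq_le_sq.2 (by rw [abs_of_nonneg hC0]; exact hC y)
    simpa using this
  have h3 : ∫ y, D y ^ 2 ∂cellMeasure ≤ δ ^ 2 := by
    rw [integral_eq_lintegral_of_nonneg_ae (hnn _) hDi.1]
    exact ENNReal.toReal_le_of_le_ofReal (sq_nonneg _) hDδ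
  refine abs_le_of_sq_le_sq ?_ (by positivity)
  calc _ ≤ _ := h1
    _ ≤ C ^ 2 * δ ^ 2 := mul_le_mul h2 h3 (integral_nonneg fun _ => sq_nonneg _) (sq_nonneg _)
    _ = (C * δ) ^ 2 := by ring

theorem integral_det_diffQuot {f g : ℝ × ℝ → ℝ} (hf : Differentiable ℝ f) (hg : Differentiable ℝ g)
    (hpf : PeriodicSnd f) (hpg : PeriodicSnd g) {s t : ℝ} (hst : s ≤ t)
    (hfx : MemLp (dx f) 2 (boxMeasure s t)) (hgx : MemLp (dx g) 2 (boxMeasure s t)) (h : ℝ) :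
    (∫ z, dx f z * diffQuot h g z ∂boxMeasure s t)
        - ∫ z, dx g z * shiftSnd (-h) (diffQuot h f) z ∂boxMeasure s t
      = ∫ y, (f (t, y) * diffQuot h g (t, y) - f (s, y) * diffQuot h g (s, y)) ∂cellMeasure := by
  have hdg := hg.diffQuot h
  have hdf := hf.diffQuot h
  have hSg : MemLp (shiftSnd h (dx g)) 2 (boxMeasure s t) :=
    MemLp.shift (measurable_dx g) hpg.dx hgx h
  have e1 : Integrable (fun z => diffQuot h g z * dx f z) (boxMeasure s t) :=
    (MemLp.continuous_mul hdg.continuous hfx).integrable one_le_two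
  have e2 : Integrable (fun z => f z * shiftSnd h (dx g) z) (boxMeasure s t) :=
    (MemLp.continuous_mul hf.continuous hSg).integrable one_le_two
  have e3 : Integrable (fun z => f z * dx g z) (boxMeasure s t) :=
    (MemLp.continuous_mul hf.continuous hgx).integrable one_le_two
  have e4 : Integrable (fun z => shiftSnd (-h) f z * dx g z) (boxMeasure s t) :=
    (MemLp.continuous_mul (hf.shiftSnd _).continuous hgx).integrable one_le_two
  have hprod : dx (fun z => f z * diffQuot h g z) = fun z =>
      diffQuot h g z * dx f z + (f z * shiftSnd h (dx g) z - f z * dx g z) / h := by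
    funext z
    rw [dx_mul hf hdg, dx_diffQuot hg]
    ring
  have e5 : Integrable (fun z => (f z * shiftSnd h (dx g) z - f z * dx g z) / h)
    (boxMeasure s t) := (e2.sub e3).div_const h
  have key := integral_dx (hf.mul hdg) hst (by
    change Integrable (dx fun z => f z * diffQuot h g z) _
    rw [hprod]
    exact e1.add e5)
  change ∫ z, dx (fun z => f z * diffQuot h g z) z ∂boxMeasure s t = _ at key
  simp only [Pi.mul_apply] at key
  rw [← key, hprod, integral_add e1 e5, integral_div, integral_sub e2 e3]
  have hK := (map_shift_box (K := fun z => shiftSnd (-h) f z * dx g z)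
    ((hf.shiftSnd _).continuous.measurable.mul (measurable_dx g))
    (fun x y => by simp only [hpf.shiftSnd (-h) x y, hpg.dx x y]) e4 h).2
  have hK' : ∫ z, f z * shiftSnd h (dx g) z ∂boxMeasure s t
      = ∫ z, shiftSnd (-h) f z * dx g z ∂boxMeasure s t := by
    rw [← hK]
    simp [shiftSnd]
  rw [hK', ← integral_sub e4 e3, ← integral_div]
  have h6 : ∀ z, dx g z * shiftSnd (-h) (diffQuot h f) z
      = -((shiftSnd (-h) f z * dx g z - f z * dx g z) / h) := by
    intro z
    simp only [shiftSnd, diffQuot, neg_add_cancel_right]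
    ring
  simp only [h6, integral_neg, sub_neg_eq_add]
  congr 1
  exact integral_congr_ae (Eventually.of_forall fun z => mul_comm _ _)

theorem tendsto_diffQuot {g : ℝ × ℝ → ℝ} (hg : Differentiable ℝ g) (z : ℝ × ℝ) :
    Tendsto (fun n : ℕ => diffQuot (1 / ((n : ℝ) + 1)) g z) atTop (𝓝 (dy g z)) := by
  have h0 := (hasDerivAt_slice_snd hg z.1 z.2).tendsto_slope_zero
  have hn : Tendsto (fun n : ℕ => 1 / ((n : ℝ) + 1)) atTop (𝓝[≠] 0) :=
    tendsto_nhdsWithin_iff.2 ⟨tendsto_one_div_add_atTop_nhds_zero_nat,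
      Eventually.of_forall fun n => (Nat.one_div_pos_of_nat (α := ℝ) (n := n)).ne'⟩
  refine (h0.comp hn).congr fun n => ?_
  simp only [diffQuot, shiftSnd, Function.comp_apply, smul_eq_mul, div_eq_inv_mul]

theorem tendsto_diffQuot_back {g : ℝ × ℝ → ℝ} (hg : Differentiable ℝ g) (z : ℝ × ℝ) :
    Tendsto (fun n : ℕ => shiftSnd (-(1 / ((n : ℝ) + 1))) (diffQuot (1 / ((n : ℝ) + 1)) g) z)
      atTop (𝓝 (dy g z)) := by
  have h0 := (hasDerivAt_slice_snd hg z.1 z.2).tendsto_slope_zero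
  have hn : Tendsto (fun n : ℕ => -(1 / ((n : ℝ) + 1))) atTop (𝓝[≠] 0) :=
    tendsto_nhdsWithin_iff.2 ⟨by simpa using (tendsto_one_div_add_atTop_nhds_zero_nat (𝕜 := ℝ)).neg,
      Eventually.of_forall fun n =>
        neg_ne_zero.2 (Nat.one_div_pos_of_nat (α := ℝ) (n := n)).ne'⟩
  refine (h0.comp hn).congr fun n => ?_
  simp only [diffQuot, shiftSnd, Function.comp_apply, smul_eq_mul, div_eq_inv_mul,
    neg_add_cancel_right, inv_neg]
  ring

/-- The Jacobian determinant is a null Lagrangian: its integral over a rectangle is controlled by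
the values on the two vertical sides. -/
theorem abs_integral_det_le {f g : ℝ × ℝ → ℝ} (hf : Differentiable ℝ f) (hg : Differentiable ℝ g)
    (hpf : PeriodicSnd f) (hpg : PeriodicSnd g) {s t : ℝ} (hst : s ≤ t)
    (hfx : MemLp (dx f) 2 (boxMeasure s t)) (hfy : MemLp (dy f) 2 (boxMeasure s t))
    (hgx : MemLp (dx g) 2 (boxMeasure s t)) (hgy : MemLp (dy g) 2 (boxMeasure s t))
    {C δ : ℝ} (hδ : 0 ≤ δ) (hCs : ∀ y, |f (s, y)| ≤ C) (hCt : ∀ y, |f (t, y)| ≤ C)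
    (hs : ∫⁻ y, ENNReal.ofReal (dy g (s, y) ^ 2) ∂cellMeasure ≤ ENNReal.ofReal (δ ^ 2))
    (ht : ∫⁻ y, ENNReal.ofReal (dy g (t, y) ^ 2) ∂cellMeasure ≤ ENNReal.ofReal (δ ^ 2)) :
    |∫ z, (dx f z * dy g z - dy f z * dx g z) ∂boxMeasure s t| ≤ 2 * C * δ := by
  have hpos : ∀ n : ℕ, 0 < 1 / ((n : ℝ) + 1) := fun n => Nat.one_div_pos_of_nat
  have hdm : ∀ {F : ℝ × ℝ → ℝ} (h : ℝ), Differentiable ℝ F → Measurable (diffQuot h F) :=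
    fun h hF => (hF.diffQuot h).continuous.measurable
  have l1 := tendsto_integral_mul_of_sq_le hfx hgy
    (φn := fun n : ℕ => diffQuot (1 / ((n : ℝ) + 1)) g) (fun n => hdm _ hg) (measurable_dy g)
    (fun n => lintegral_diffQuot_sq_le hg hpg s t (hpos n)) (tendsto_diffQuot hg)
  have l2 := tendsto_integral_mul_of_sq_le hgx hfy
    (φn := fun n : ℕ => shiftSnd (-(1 / ((n : ℝ) + 1))) (diffQuot (1 / ((n : ℝ) + 1)) f))
    (fun n => ((hf.diffQuot _).shiftSnd _).continuous.measurable) (measurable_dy f)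
    (fun n => by
      have hm := hdm (1 / ((n : ℝ) + 1)) hf
      refine (lintegral_box_shift (φ := fun z => ENNReal.ofReal
        (diffQuot (1 / ((n : ℝ) + 1)) f z ^ 2)) (by fun_prop) (fun x y => ?_) s t _).le.trans
        (lintegral_diffQuot_sq_le hf hpf s t (hpos n))
      simp only [diffQuot, hpf x y, hpf.shiftSnd _ x y]) (tendsto_diffQuot_back hf)
  have l3 := (l1.sub l2).abs
  have e1 : Integrable (fun z => dx f z * dy g z) (boxMeasure s t) := hfx.integrable_mul hgy
  have e2 : Integrable (fun z => dx g z * dy f z) (boxMeasure s t) := hgx.integrable_mul hfy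
  have h1 : ∫ z, (dx f z * dy g z - dy f z * dx g z) ∂boxMeasure s t
      = (∫ z, dx f z * dy g z ∂boxMeasure s t) - ∫ z, dx g z * dy f z ∂boxMeasure s t := by
    rw [← integral_sub e1 e2]
    exact integral_congr_ae (Eventually.of_forall fun z => by ring)
  rw [h1]
  refine le_of_tendsto l3 (Eventually.of_forall fun n => ?_)
  rw [integral_det_diffQuot hf hg hpf hpg hst hfx hgx]
  have hb : ∀ x : ℝ, (∀ y, |f (x, y)| ≤ C) →
      ∫⁻ y, ENNReal.ofReal (dy g (x, y) ^ 2) ∂cellMeasure ≤ ENNReal.ofReal (δ ^ 2) →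
      |∫ y, f (x, y) * diffQuot (1 / ((n : ℝ) + 1)) g (x, y) ∂cellMeasure| ≤ C * δ := by
    intro x hC hx
    refine abs_integral_mul_le_of_lintegral_sq
      (hf.continuous.comp (by fun_prop)) ((hg.diffQuot _).continuous.comp (by fun_prop)) hδ hC ?_
    refine le_trans ?_ hx
    exact lintegral_cell_diffQuot_sq_le (hasDerivAt_slice_snd hg x) (hpg.dy x) (hpos n)
  have hi : ∀ x : ℝ, Integrable (fun y => f (x, y) * diffQuot (1 / ((n : ℝ) + 1)) g (x, y))
      cellMeasure := fun x => by
    have hc : Continuous fun y => f (x, y) * diffQuot (1 / ((n : ℝ) + 1)) g (x, y) :=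
      (hf.continuous.comp (by fun_prop)).mul ((hg.diffQuot _).continuous.comp (by fun_prop))
    exact (hc.integrableOn_Icc (a := 0) (b := 1)).mono_set Set.Ioc_subset_Icc_self
  rw [integral_sub (hi t) (hi s)]
  refine (abs_sub _ _).trans ?_
  linarith [hb t hCt ht, hb s hCs hs]

theorem abs_sub_le_integral_abs {k k' : ℝ → ℝ} (hk : ∀ x, HasDerivAt k (k' x) x) {s t : ℝ}
    (hi : IntegrableOn k' (Set.Ioc s t)) {x y : ℝ} (hx : x ∈ Set.Icc s t) (hy : y ∈ Set.Icc s t) :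
    |k x - k y| ≤ ∫ r in Set.Ioc s t, |k' r| := by
  wlog hyx : y ≤ x generalizing x y
  · rw [abs_sub_comm]
    exact this hy hx (le_of_not_ge hyx)
  have hsub : Set.Ioc y x ⊆ Set.Ioc s t := Set.Ioc_subset_Ioc hy.1 hx.2
  rw [← intervalIntegral.integral_eq_sub_of_hasDerivAt (fun r _ => hk r)
    ((intervalIntegrable_iff_integrableOn_Ioc_of_le hyx).2 (hi.mono_set hsub)),
    intervalIntegral.integral_of_le hyx]
  refine (abs_integral_le_integral_abs).trans ?_
  exact setIntegral_mono_set hi.abs (Eventually.of_forall fun _ => abs_nonneg _) hsub.eventuallyLE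

/-- A `W^{1,1} ⊂ L²` inequality on a rectangle for functions vanishing on the left side. -/
theorem integral_sq_le_of_eq_zero_left {η : ℝ × ℝ → ℝ} (hη : Differentiable ℝ η) {s t : ℝ}
    (hst : s ≤ t) (h0 : ∀ y, η (s, y) = 0) (hx : MemLp (dx η) 2 (boxMeasure s t))
    (hy : MemLp (dy η) 2 (boxMeasure s t)) :
    ∫ z, η z ^ 2 ∂boxMeasure s t ≤ (∫ z, |dx η z| ∂boxMeasure s t) *
      ((t - s) * (∫ z, |dx η z| ∂boxMeasure s t) + ∫ z, |dy η z| ∂boxMeasure s t) := by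
  have hηi : Integrable (fun z => η z ^ 2) (boxMeasure s t) :=
    hη.continuous.memLp_box.integrable_sq
  have hxi := hx.integrable one_le_two
  have hyi := hy.integrable one_le_two
  unfold boxMeasure at *
  set μ := (volume : Measure ℝ).restrict (Set.Ioc s t)
  set a : ℝ → ℝ := fun y => ∫ x, |dx η (x, y)| ∂μ with ha
  set b : ℝ → ℝ := fun x => ∫ y, |dy η (x, y)| ∂cellMeasure with hb
  have hai : Integrable a cellMeasure := hxi.abs.integral_prod_right
  have hbi : Integrable b μ := hyi.abs.integral_prod_left
  have hA : ∫ z, |dx η z| ∂μ.prod cellMeasure = ∫ y, a y ∂cellMeasure :=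
    integral_prod_symm _ hxi.abs
  have hB : ∫ z, |dy η z| ∂μ.prod cellMeasure = ∫ x, b x ∂μ := integral_prod _ hyi.abs
  have gy : ∀ᵐ y ∂cellMeasure, ∀ x ∈ Set.Icc s t, |η (x, y)| ≤ a y := by
    filter_upwards [hxi.prod_left_ae] with y hyy x hxx
    have := abs_sub_le_integral_abs (fun x => hasDerivAt_slice_fst hη x y) hyy hxx
      (Set.left_mem_Icc.2 hst)
    simpa [h0] using this
  have gx : ∀ᵐ x ∂μ, x ∈ Set.Icc s t ∧ ∀ y ∈ Set.Icc (0 : ℝ) 1, ∀ y' ∈ Set.Icc (0 : ℝ) 1,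
      |η (x, y) - η (x, y')| ≤ b x := by
    filter_upwards [hyi.prod_right_ae, ae_restrict_mem measurableSet_Ioc] with x hxx hm
    exact ⟨Set.Ioc_subset_Icc_self hm, fun y hy y' hy' =>
      abs_sub_le_integral_abs (fun y => hasDerivAt_slice_snd hη x y) hxx hy hy'⟩
  have gm : ∀ᵐ y ∂cellMeasure, y ∈ Set.Icc (0 : ℝ) 1 := by
    filter_upwards [ae_restrict_mem (measurableSet_Ioc (a := (0 : ℝ)) (b := 1))] with y hm
    exact Set.Ioc_subset_Icc_self hm
  set A := ∫ y, a y ∂cellMeasure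
  have gx' : ∀ᵐ x ∂μ, x ∈ Set.Icc s t ∧ ∀ y ∈ Set.Icc (0 : ℝ) 1, |η (x, y)| ≤ A + b x := by
    filter_upwards [gx] with x hxx
    refine ⟨hxx.1, fun y hym => ?_⟩
    have h1 : ∀ᵐ y' ∂cellMeasure, |η (x, y)| ≤ a y' + b x := by
      filter_upwards [gy, gm] with y' h1 h2
      have h3 := hxx.2 y hym y' h2
      have h4 := abs_sub_abs_le_abs_sub (η (x, y)) (η (x, y'))
      linarith [h1 x hxx.1]
    have h2 := integral_mono_ae (integrable_const |η (x, y)|) (hai.add (integrable_const (b x))) h1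
    simp only [Pi.add_apply] at h2
    rw [integral_add hai (integrable_const _)] at h2
    simpa using h2
  have hall : ∀ᵐ z ∂μ.prod cellMeasure, η z ^ 2 ≤ (A + b z.1) * a z.2 := by
    filter_upwards [Measure.quasiMeasurePreserving_fst.ae gx',
      Measure.quasiMeasurePreserving_snd.ae gy, Measure.quasiMeasurePreserving_snd.ae gm]
      with z h1 h2 h3
    rw [← sq_abs, sq]
    exact mul_le_mul (h1.2 _ h3) (h2 _ h1.1) (abs_nonneg _) ((abs_nonneg _).trans (h1.2 _ h3))
  have hAbi : Integrable (fun x => A + b x) μ := (integrable_const A).add hbi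
  have h5 := integral_mono_ae hηi (hAbi.mul_prod hai) hall
  rw [integral_prod_mul (fun x => A + b x) a, integral_add (integrable_const A) hbi] at h5
  rw [hA, hB]
  refine h5.trans_eq ?_
  simp only [μ, integral_const, measureReal_restrict_apply_univ, Real.volume_real_Ioc_of_le hst,
    smul_eq_mul]
  ring

theorem sq_integral_abs_le {α : Type*} [MeasurableSpace α] {μ : Measure α} [IsFiniteMeasure μ]
    {P : α → ℝ} (hP : MemLp P 2 μ) {Γ : Set α} (hΓ : MeasurableSet Γ) (h : ∀ x ∉ Γ, P x = 0) :
    (∫ x, |P x| ∂μ) ^ 2 ≤ μ.real Γ * ∫ x, P x ^ 2 ∂μ := by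
  have h1 : MemLp (Γ.indicator fun _ => (1 : ℝ)) 2 μ := (memLp_const 1).indicator hΓ
  have h2 := sq_integral_mul_le h1 hP.abs
  have h3 : ∀ x, Γ.indicator (fun _ => (1 : ℝ)) x * |P x| = |P x| := fun x => by
    by_cases hx : x ∈ Γ
    · simp [hx]
    · simp [hx, h x hx]
  have h4 : ∀ x, Γ.indicator (fun _ => (1 : ℝ)) x ^ 2 = Γ.indicator (fun _ => (1 : ℝ)) x := fun x => by
    by_cases hx : x ∈ Γ <;> simp [hx]
  simp only [h3, h4, Pi.abs_apply, sq_abs] at h2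
  rwa [integral_indicator_const _ hΓ, smul_eq_mul, mul_one] at h2

/-- Absorption argument: a Caccioppoli type inequality, combined with the `W^{1,1} ⊂ L²` inequality,
forces `η = 0` as soon as the gradient is concentrated on a set of small measure. -/
theorem integral_sq_eq_zero_of_small {α : Type*} [MeasurableSpace α] {μ : Measure α}
    [IsFiniteMeasure μ] {η P Q : α → ℝ} (hη : MemLp η 2 μ) (hP : MemLp P 2 μ) (hQ : MemLp Q 2 μ)
    {B ℓ : ℝ} (hℓ : 0 ≤ ℓ)
    (h1 : 3 / 4 * ∫ x, (P x ^ 2 + Q x ^ 2) ∂μ ≤ B / 2 * ∫ x, η x * (|P x| + |Q x|) ∂μ)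
    (h2 : ∫ x, η x ^ 2 ∂μ ≤ (∫ x, |P x| ∂μ) * (ℓ * (∫ x, |P x| ∂μ) + ∫ x, |Q x| ∂μ))
    {Γ : Set α} (hΓ : MeasurableSet Γ) (hPΓ : ∀ x ∉ Γ, P x = 0) (hQΓ : ∀ x ∉ Γ, Q x = 0)
    (hsmall : B ^ 2 * ((ℓ + 1) * μ.real Γ) < 1) : ∫ x, η x ^ 2 ∂μ = 0 := by
  have hN0 : 0 ≤ ∫ x, η x ^ 2 ∂μ := integral_nonneg fun _ => sq_nonneg _
  have a1 := sq_integral_abs_le hP hΓ hPΓ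
  have b1 := sq_integral_abs_le hQ hΓ hQΓ
  have hS : ∫ x, (P x ^ 2 + Q x ^ 2) ∂μ = ∫ x, P x ^ 2 ∂μ + ∫ x, Q x ^ 2 ∂μ :=
    integral_add hP.integrable_sq hQ.integrable_sq
  have hP0 : 0 ≤ ∫ x, P x ^ 2 ∂μ := integral_nonneg fun _ => sq_nonneg _
  have hQ0 : 0 ≤ ∫ x, Q x ^ 2 ∂μ := integral_nonneg fun _ => sq_nonneg _
  have hPQ : MemLp (fun x => |P x| + |Q x|) 2 μ := hP.abs.add hQ.abs
  have c1 := sq_integral_mul_le hη hPQ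
  have c2 : ∫ x, (|P x| + |Q x|) ^ 2 ∂μ ≤ 2 * ∫ x, (P x ^ 2 + Q x ^ 2) ∂μ := by
    rw [← integral_const_mul]
    refine integral_mono hPQ.integrable_sq ((hP.integrable_sq.add hQ.integrable_sq).const_mul 2)
      fun x => ?_
    nlinarith [sq_nonneg (|P x| - |Q x|), sq_abs (P x), sq_abs (Q x)]
  have hA0 : 0 ≤ ∫ x, |P x| ∂μ := integral_nonneg fun _ => abs_nonneg _
  have hB0 : 0 ≤ ∫ x, |Q x| ∂μ := integral_nonneg fun _ => abs_nonneg _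
  have hm : 0 ≤ μ.real Γ := measureReal_nonneg
  generalize (∫ x, η x * (|P x| + |Q x|) ∂μ) = T at *
  generalize (∫ x, (|P x| + |Q x|) ^ 2 ∂μ) = T2 at *
  generalize (∫ x, (P x ^ 2 + Q x ^ 2) ∂μ) = S at *
  generalize (∫ x, P x ^ 2 ∂μ) = p at *
  generalize (∫ x, Q x ^ 2 ∂μ) = q at *
  generalize (∫ x, |P x| ∂μ) = A at *
  generalize (∫ x, |Q x| ∂μ) = D at *
  generalize (∫ x, η x ^ 2 ∂μ) = N at *
  generalize μ.real Γ = m at *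
  subst hS
  have hS0 : 0 ≤ p + q := by linarith
  have hAD : A ^ 2 ≤ m * (p + q) := by nlinarith
  have hDD : D ^ 2 ≤ m * (p + q) := by nlinarith
  have hN : N ≤ (ℓ + 1) * m * (p + q) := by nlinarith [sq_nonneg (A - D)]
  have hT : T ^ 2 ≤ 2 * N * (p + q) := by nlinarith
  have hsq : (3 / 4 * (p + q)) ^ 2 ≤ (B / 2 * T) ^ 2 := by
    apply sq_le_sq'
    · nlinarith
    · exact h1
  have h7 : (p + q) * (p + q) ≤ B ^ 2 * N * (p + q) := by
    nlinarith [mul_le_mul_of_nonneg_left hT (sq_nonneg B),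
      mul_nonneg (mul_nonneg (sq_nonneg B) hN0) hS0]
  have h8 : p + q ≤ 0 := by
    by_contra hpos
    push Not at hpos
    have h9 : p + q ≤ B ^ 2 * N := le_of_mul_le_mul_right h7 hpos
    have h10 : B ^ 2 * N ≤ B ^ 2 * ((ℓ + 1) * m) * (p + q) := by
      nlinarith [mul_le_mul_of_nonneg_left hN (sq_nonneg B)]
    nlinarith
  have h11 : p + q = 0 := le_antisymm h8 hS0
  rw [h11, mul_zero] at hN
  linarith

theorem hasDerivAt_max_pow (n : ℕ) (s : ℝ) :
    HasDerivAt (fun s : ℝ => max s 0 ^ (n + 2)) ((n + 2) * max s 0 ^ (n + 1)) s := by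
  rcases lt_trichotomy s 0 with h | h | h
  · have : (fun s : ℝ => max s 0 ^ (n + 2)) =ᶠ[𝓝 s] fun _ => 0 := by
      filter_upwards [Iio_mem_nhds h] with x hx
      simp [max_eq_right (le_of_lt (Set.mem_Iio.1 hx))]
    rw [max_eq_right h.le, zero_pow (Nat.succ_ne_zero n), mul_zero]
    exact (hasDerivAt_const s (0 : ℝ)).congr_of_eventuallyEq this
  · subst h
    rw [hasDerivAt_iff_isLittleO]
    simp only [max_self, sub_zero, ne_eq, Nat.add_eq_zero_iff, OfNat.ofNat_ne_zero, and_false,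
      not_false_eq_true, zero_pow, one_ne_zero, mul_zero, smul_zero]
    refine Asymptotics.IsBigO.trans_isLittleO (Asymptotics.IsBigO.of_bound 1 ?_)
      (Asymptotics.isLittleO_pow_id (show 1 < n + 2 by omega))
    refine Eventually.of_forall fun x => ?_
    rw [norm_pow, norm_pow, one_mul, Real.norm_eq_abs, Real.norm_eq_abs]
    refine pow_le_pow_left₀ (abs_nonneg _) ?_ _
    rcases le_total x 0 with hx | hx <;> simp [hx]
  · have : (fun s : ℝ => max s 0 ^ (n + 2)) =ᶠ[𝓝 s] fun s => s ^ (n + 2) := by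
      filter_upwards [Ioi_mem_nhds h] with x hx
      rw [max_eq_left (le_of_lt (Set.mem_Ioi.1 hx))]
    rw [max_eq_left h.le]
    have h2 := (hasDerivAt_pow (n + 2) s).congr_of_eventuallyEq this
    have h3 : ((n : ℝ) + 2) * s ^ (n + 1) = ((n + 2 : ℕ) : ℝ) * s ^ (n + 2 - 1) := by
      push_cast
      rfl
    rw [h3]
    exact h2

/-- Powers of the truncation `(F - k)₊`. -/
def truncPow (F : ℝ × ℝ → ℝ) (k : ℝ) (n : ℕ) (z : ℝ × ℝ) : ℝ := max (F z - k) 0 ^ n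

theorem hasFDerivAt_truncPow {F : ℝ × ℝ → ℝ} (hF : Differentiable ℝ F) (k : ℝ) (n : ℕ)
    (z : ℝ × ℝ) :
    HasFDerivAt (truncPow F k (n + 2)) (((n + 2) * truncPow F k (n + 1) z) • fderiv ℝ F z) z :=
  HasDerivAt.comp_hasFDerivAt (h₂ := fun s : ℝ => max s 0 ^ (n + 2)) z
    (hasDerivAt_max_pow n (F z - k)) ((hF z).hasFDerivAt.sub_const k)

theorem continuous_truncPow {F : ℝ × ℝ → ℝ} (hF : Continuous F) (k : ℝ) (n : ℕ) :
    Continuous (truncPow F k n) := by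
  unfold truncPow; fun_prop

theorem dx_truncPow {F : ℝ × ℝ → ℝ} (hF : Differentiable ℝ F) (k : ℝ) (n : ℕ) (z : ℝ × ℝ) :
    dx (truncPow F k (n + 2)) z = (n + 2) * truncPow F k (n + 1) z * dx F z := by
  rw [dx, (hasFDerivAt_truncPow hF k n z).fderiv]; simp [dx]

theorem dy_truncPow {F : ℝ × ℝ → ℝ} (hF : Differentiable ℝ F) (k : ℝ) (n : ℕ) (z : ℝ × ℝ) :
    dy (truncPow F k (n + 2)) z = (n + 2) * truncPow F k (n + 1) z * dy F z := by
  rw [dy, (hasFDerivAt_truncPow hF k n z).fderiv]; simp [dy]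

theorem fderiv_eq_dx_dy (w : ℝ × ℝ → ℝ) (z v : ℝ × ℝ) :
    fderiv ℝ w z v = v.1 * dx w z + v.2 * dy w z := by
  have : v = v.1 • ((1 : ℝ), (0 : ℝ)) + v.2 • ((0 : ℝ), (1 : ℝ)) := by ext <;> simp
  conv_lhs => rw [this, map_add, map_smul, map_smul]
  simp [dx, dy]

theorem hasFDerivAt_comp_prodMk {w f g : ℝ × ℝ → ℝ} (hw : Differentiable ℝ w)
    (hf : Differentiable ℝ f) (hg : Differentiable ℝ g) (z : ℝ × ℝ) :
    HasFDerivAt (fun z => w (f z, g z))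
      ((fderiv ℝ w (f z, g z)).comp ((fderiv ℝ f z).prod (fderiv ℝ g z))) z :=
  (hw (f z, g z)).hasFDerivAt.comp z ((hf z).hasFDerivAt.prodMk (hg z).hasFDerivAt)

theorem dx_comp_prodMk {w f g : ℝ × ℝ → ℝ} (hw : Differentiable ℝ w)
    (hf : Differentiable ℝ f) (hg : Differentiable ℝ g) (z : ℝ × ℝ) :
    dx (fun z => w (f z, g z)) z = dx f z * dx w (f z, g z) + dx g z * dy w (f z, g z) := by
  rw [dx, (hasFDerivAt_comp_prodMk hw hf hg z).fderiv]
  rw [ContinuousLinearMap.comp_apply, fderiv_eq_dx_dy w]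
  rfl

theorem dy_comp_prodMk {w f g : ℝ × ℝ → ℝ} (hw : Differentiable ℝ w)
    (hf : Differentiable ℝ f) (hg : Differentiable ℝ g) (z : ℝ × ℝ) :
    dy (fun z => w (f z, g z)) z = dy f z * dx w (f z, g z) + dy g z * dy w (f z, g z) := by
  rw [dy, (hasFDerivAt_comp_prodMk hw hf hg z).fderiv]
  rw [ContinuousLinearMap.comp_apply, fderiv_eq_dx_dy w]
  rfl

/-- Differentiable functions on the cylinder with square integrable gradient on rectangles. -/
structure PeriodicSobolev (F : ℝ × ℝ → ℝ) : Prop where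
  diff : Differentiable ℝ F
  per : PeriodicSnd F
  memLp_dx : ∀ s t, MemLp (dx F) 2 (boxMeasure s t)
  memLp_dy : ∀ s t, MemLp (dy F) 2 (boxMeasure s t)

theorem PeriodicSobolev.truncPow {F : ℝ × ℝ → ℝ} (hF : PeriodicSobolev F) (k : ℝ) (n : ℕ) :
    PeriodicSobolev (truncPow F k (n + 2)) where
  diff z := (hasFDerivAt_truncPow hF.diff k n z).differentiableAt
  per x y := by simp only [_root_.truncPow, hF.per x y]
  memLp_dx s t := by
    simp only [funext (dx_truncPow hF.diff k n)]
    exact MemLp.continuous_mul ((continuous_truncPow hF.diff.continuous k _).const_mul _)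
      (hF.memLp_dx s t)
  memLp_dy s t := by
    simp only [funext (dy_truncPow hF.diff k n)]
    exact MemLp.continuous_mul ((continuous_truncPow hF.diff.continuous k _).const_mul _)
      (hF.memLp_dy s t)

theorem PeriodicSobolev.neg {F : ℝ × ℝ → ℝ} (hF : PeriodicSobolev F) :
    PeriodicSobolev (fun z => -F z) where
  diff := hF.diff.neg
  per x y := by simp only [hF.per x y]
  memLp_dx s t := by
    have : dx (fun z => -F z) = fun z => -dx F z := by
      funext z; simp [dx]
    rw [this]
    exact (hF.memLp_dx s t).neg
  memLp_dy s t := by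
    have : dy (fun z => -F z) = fun z => -dy F z := by
      funext z; simp [dy]
    rw [this]
    exact (hF.memLp_dy s t).neg

theorem caccioppoli {f g w : ℝ × ℝ → ℝ} (hf : PeriodicSobolev f) (hg : PeriodicSobolev g)
    (hw : Differentiable ℝ w) (hwx : Continuous (dx w)) (hwy : Continuous (dy w))
    (hdiv : ∀ z, dy g z = -dx f z) {s t : ℝ} (hst : s ≤ t)
    (heq : ∀ᵐ z ∂boxMeasure s t, dx g z - dy f z = w (f z, g z)) {k : ℝ}
    (hs : ∀ y, f (s, y) ≤ k) (ht : ∀ y, f (t, y) ≤ k) {δ : ℝ} (hδ : 0 ≤ δ)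
    (hgs : ∫⁻ y, ENNReal.ofReal (dy g (s, y) ^ 2) ∂cellMeasure ≤ ENNReal.ofReal (δ ^ 2))
    (hgt : ∫⁻ y, ENNReal.ofReal (dy g (t, y) ^ 2) ∂cellMeasure ≤ ENNReal.ofReal (δ ^ 2))
    {B : ℝ} (hBx : ∀ z ∈ Set.Icc s t ×ˢ Set.Icc (0 : ℝ) 1, |dx w (f z, g z)| ≤ B)
    (hBy : ∀ z ∈ Set.Icc s t ×ˢ Set.Icc (0 : ℝ) 1, |dy w (f z, g z)| ≤ B) :
    3 / 4 * ∫ z, (dx (truncPow f k 2) z ^ 2 + dy (truncPow f k 2) z ^ 2) ∂boxMeasure s t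
      ≤ B / 2 * ∫ z, truncPow f k 2 z *
        (|dx (truncPow f k 2) z| + |dy (truncPow f k 2) z|) ∂boxMeasure s t := by
  have hη := hf.truncPow k 0
  have hh := hf.truncPow k 1
  set η := truncPow f k (0 + 2) with hηdef
  set h := truncPow f k (1 + 2) with hhdef
  have hwf : Differentiable ℝ fun z => w (f z, g z) := fun z =>
    (hasFDerivAt_comp_prodMk hw hf.diff hg.diff z).differentiableAt
  have hfg : Continuous fun z => (f z, g z) := hf.diff.continuous.prodMk hg.diff.continuous
  have i1 : Integrable (fun z => dx h z * dy g z - dy h z * dx g z) (boxMeasure s t) :=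
    ((hh.memLp_dx s t).integrable_mul (hg.memLp_dy s t)).sub
      ((hh.memLp_dy s t).integrable_mul (hg.memLp_dx s t))
  have e1 : ∫ z, (dx h z * dy g z - dy h z * dx g z) ∂boxMeasure s t = 0 := by
    have := abs_integral_det_le hh.diff hg.diff hh.per hg.per hst (hh.memLp_dx s t)
      (hh.memLp_dy s t) (hg.memLp_dx s t) (hg.memLp_dy s t) (C := 0) hδ
      (fun y => by simp [hhdef, truncPow, max_eq_right (sub_nonpos.2 (hs y))])
      (fun y => by simp [hhdef, truncPow, max_eq_right (sub_nonpos.2 (ht y))]) hgs hgt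
    simpa using this
  have d2 : ∀ z, dy (fun z => h z * w (f z, g z)) z = dy h z * w (f z, g z)
      + h z * (dy f z * dx w (f z, g z) + dy g z * dy w (f z, g z)) := fun z => by
    rw [dy_mul hh.diff hwf, dy_comp_prodMk hw hf.diff hg.diff]
  have i2 : Integrable (dy (fun z => h z * w (f z, g z))) (boxMeasure s t) := by
    have m1 := MemLp.continuous_mul hwf.continuous (hh.memLp_dy s t)
    have m2 := MemLp.continuous_mul (hh.diff.continuous.mul (hwx.comp hfg)) (hf.memLp_dy s t)
    have m3 := MemLp.continuous_mul (hh.diff.continuous.mul (hwy.comp hfg)) (hg.memLp_dy s t)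
    refine (((m1.add m2).add m3).integrable one_le_two).congr (Eventually.of_forall fun z => ?_)
    simp only [d2, Pi.add_apply, Pi.mul_apply, Function.comp_apply]
    ring
  have e2 : ∫ z, dy (fun z => h z * w (f z, g z)) z ∂boxMeasure s t = 0 :=
    integral_dy (hh.diff.mul hwf) (fun x y => by
      simp only [Pi.mul_apply, hh.per x y, hf.per x y, hg.per x y]) i2
  have i3 : Integrable (fun z => dx η z ^ 2 + dy η z ^ 2) (boxMeasure s t) :=
    (hη.memLp_dx s t).integrable_sq.add (hη.memLp_dy s t).integrable_sq
  have i4 : Integrable (fun z => η z * (|dx η z| + |dy η z|)) (boxMeasure s t) :=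
    (MemLp.continuous_mul hη.diff.continuous
      ((hη.memLp_dx s t).abs.add (hη.memLp_dy s t).abs)).integrable one_le_two
  have key := integral_mono_ae (((i3.const_mul (3 / 4)).add i1).add i2) (i4.const_mul (B / 2)) ?_
  · rw [integral_add' ((i3.const_mul (3 / 4)).add i1) i2, integral_add' (i3.const_mul (3 / 4)) i1,
      e1, e2, integral_const_mul, integral_const_mul] at key
    simpa using key
  filter_upwards [heq, ae_boxMeasure_mem s t] with z h1 hz
  have hr : dx g z = dy f z + w (f z, g z) := by linarith
  have a1 : dx h z = 3 * truncPow f k 2 z * dx f z := by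
    rw [hhdef, dx_truncPow hf.diff]; norm_num
  have a2 : dy h z = 3 * truncPow f k 2 z * dy f z := by
    rw [hhdef, dy_truncPow hf.diff]; norm_num
  have a3 : dx η z = 2 * truncPow f k 1 z * dx f z := by
    rw [hηdef, dx_truncPow hf.diff]; norm_num
  have a4 : dy η z = 2 * truncPow f k 1 z * dy f z := by
    rw [hηdef, dy_truncPow hf.diff]; norm_num
  simp only [Pi.add_apply, d2, a1, a2, a3, a4, hr, hdiv z]
  have b1 : truncPow f k 1 z = max (f z - k) 0 := by simp [truncPow]
  have b2 : truncPow f k 2 z = max (f z - k) 0 ^ 2 := by simp [truncPow]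
  have b3 : h z = max (f z - k) 0 ^ 3 := by simp [hhdef, truncPow]
  have b4 : η z = max (f z - k) 0 ^ 2 := by simp [hηdef, truncPow]
  have hψ : 0 ≤ max (f z - k) 0 := le_max_right _ _
  rw [b1, b2, b3, b4]
  generalize max (f z - k) 0 = ψ at *
  have c1 := hBx z hz
  have c2 := hBy z hz
  have hB : 0 ≤ B := (abs_nonneg _).trans c1
  rw [abs_mul (2 * ψ), abs_mul (2 * ψ), abs_of_nonneg (by positivity : 0 ≤ 2 * ψ)]
  have k1 : dy f z * dx w (f z, g z) ≤ |dy f z| * B :=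
    (le_abs_self _).trans (by rw [abs_mul]; gcongr)
  have k2 : -dx f z * dy w (f z, g z) ≤ |dx f z| * B :=
    (le_abs_self _).trans (by rw [abs_mul, abs_neg]; gcongr)
  have k3 := mul_le_mul_of_nonneg_left (add_le_add k1 k2) (pow_nonneg hψ 3)
  nlinarith [k3]

theorem PeriodicSnd.exists_mem_Icc {F : ℝ × ℝ → ℝ} (hF : PeriodicSnd F) (y : ℝ) :
    ∃ y' ∈ Set.Icc (0 : ℝ) 1, ∀ x, F (x, y) = F (x, y') :=
  ⟨Int.fract y, ⟨Int.fract_nonneg y, (Int.fract_lt_one y).le⟩, fun x => by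
    have h : Function.Periodic (fun y => F (x, y)) 1 := hF x
    have := h.sub_int_mul_eq (x := y) ⌊y⌋
    simp only [mul_one] at this
    exact this.symm⟩

theorem le_of_elliptic {f g w : ℝ × ℝ → ℝ} (hf : PeriodicSobolev f) (hg : PeriodicSobolev g)
    (hw : Differentiable ℝ w) (hwx : Continuous (dx w)) (hwy : Continuous (dy w))
    (hdiv : ∀ z, dy g z = -dx f z) {s t : ℝ} (hst : s ≤ t)
    (heq : ∀ᵐ z ∂boxMeasure s t, dx g z - dy f z = w (f z, g z)) {k : ℝ}
    (hs : ∀ y, f (s, y) ≤ k) (ht : ∀ y, f (t, y) ≤ k) {δ : ℝ} (hδ : 0 ≤ δ)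
    (hgs : ∫⁻ y, ENNReal.ofReal (dy g (s, y) ^ 2) ∂cellMeasure ≤ ENNReal.ofReal (δ ^ 2))
    (hgt : ∫⁻ y, ENNReal.ofReal (dy g (t, y) ^ 2) ∂cellMeasure ≤ ENNReal.ofReal (δ ^ 2)) :
    ∀ x ∈ Set.Icc s t, ∀ y, f (x, y) ≤ k := by
  have hK : IsCompact (Set.Icc s t ×ˢ Set.Icc (0 : ℝ) 1) := isCompact_Icc.prod isCompact_Icc
  have hfc := hf.diff.continuous
  have hfg : Continuous fun z => (f z, g z) := hfc.prodMk hg.diff.continuous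
  obtain ⟨z₀, hz₀, hmax⟩ := hK.exists_isMaxOn
    ⟨(s, 0), Set.left_mem_Icc.2 hst, Set.left_mem_Icc.2 zero_le_one⟩ hfc.continuousOn
  have hle : ∀ x ∈ Set.Icc s t, ∀ y, f (x, y) ≤ f z₀ := fun x hx y => by
    obtain ⟨y', hy', h⟩ := hf.per.exists_mem_Icc y
    rw [h]
    exact hmax (Set.mk_mem_prod hx hy')
  by_contra! hcon
  obtain ⟨x₁, hx₁, y₁, hlt⟩ := hcon
  have hM : k < f z₀ := hlt.trans_le (hle x₁ hx₁ y₁)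
  have hlt_of : ∀ x ∈ Set.Icc s t, ∀ y, k < f (x, y) → s < x ∧ x < t := fun x hx y h => by
    refine ⟨lt_of_le_of_ne hx.1 ?_, lt_of_le_of_ne hx.2 ?_⟩
    · rintro rfl; exact absurd (hs y) h.not_ge
    · rintro rfl; exact absurd (ht y) h.not_ge
  obtain ⟨B₁, hB₁⟩ := hK.exists_bound_of_continuousOn (hwx.comp hfg).continuousOn
  obtain ⟨B₂, hB₂⟩ := hK.exists_bound_of_continuousOn (hwy.comp hfg).continuousOn
  set B := max B₁ B₂
  set κ : ℕ → ℝ := fun n => f z₀ - (f z₀ - k) * (1 / ((n : ℝ) + 1)) with hκ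
  have hκk : ∀ n, k ≤ κ n := fun n => by
    have h1 : 1 / ((n : ℝ) + 1) ≤ 1 := by
      rw [div_le_one (by positivity)]; linarith [n.cast_nonneg (α := ℝ)]
    have := mul_le_mul_of_nonneg_left h1 (sub_pos.2 hM).le
    simp only [hκ]; linarith
  have hκM : ∀ n, κ n < f z₀ := fun n => by
    have := mul_pos (sub_pos.2 hM) (Nat.one_div_pos_of_nat (α := ℝ) (n := n))
    simp only [hκ]; linarith
  have hκmono : Monotone κ := fun m n hmn => by
    have := mul_le_mul_of_nonneg_left (Nat.one_div_le_one_div (α := ℝ) hmn) (sub_pos.2 hM).le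
    simp only [hκ]; linarith
  have hκlim : Tendsto κ atTop (𝓝 (f z₀)) := by
    have := (tendsto_one_div_add_atTop_nhds_zero_nat (𝕜 := ℝ)).const_mul (f z₀ - k)
    simpa [hκ] using this.const_sub (f z₀)
  set Γ : ℕ → Set (ℝ × ℝ) := fun n => {z | κ n < f z ∧ (dx f z ≠ 0 ∨ dy f z ≠ 0)} with hΓ
  have hΓm : ∀ n, MeasurableSet (Γ n) := fun n =>
    (measurableSet_lt measurable_const hfc.measurable).inter
      (((measurable_dx f) (measurableSet_singleton 0).compl).union
        ((measurable_dy f) (measurableSet_singleton 0).compl))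
  have hΓanti : Antitone Γ := fun m n hmn z hz => ⟨(hκmono hmn).trans_lt hz.1, hz.2⟩
  have hinter : boxMeasure s t (⋂ n, Γ n) = 0 := by
    refine measure_mono_null (t := (Set.Icc s t ×ˢ Set.Icc (0 : ℝ) 1)ᶜ) ?_ (ae_boxMeasure_mem s t)
    intro z hz hzK
    rw [Set.mem_iInter] at hz
    have h1 : f z₀ ≤ f z := le_of_tendsto' hκlim fun n => (hz n).1.le
    have h2 := hlt_of z.1 hzK.1 z.2 (hM.trans_le h1)
    have h3 : IsLocalMax f z := by
      filter_upwards [(isOpen_Ioo.preimage continuous_fst).mem_nhds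
        (show z ∈ Prod.fst ⁻¹' Set.Ioo s t from h2)] with y hy
      exact (hle y.1 (Set.Ioo_subset_Icc_self hy) y.2).trans h1
    have h4 := h3.fderiv_eq_zero
    have h5 := (hz 0).2
    simp [dx, dy, h4] at h5
  have hlim : Tendsto (fun n => (boxMeasure s t).real (Γ n)) atTop (𝓝 0) := by
    have := tendsto_measure_iInter_atTop (μ := boxMeasure s t)
      (fun n => (hΓm n).nullMeasurableSet) hΓanti ⟨0, measure_ne_top _ _⟩
    rw [hinter] at this
    exact (ENNReal.tendsto_toReal ENNReal.zero_ne_top).comp this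
  have hlim' : Tendsto (fun n => B ^ 2 * ((t - s + 1) * (boxMeasure s t).real (Γ n))) atTop
      (𝓝 0) := by
    simpa using (hlim.const_mul (t - s + 1)).const_mul (B ^ 2)
  obtain ⟨n, hn⟩ := (hlim'.eventually_lt_const zero_lt_one).exists
  have hη := hf.truncPow (κ n) 0
  have hzero : ∀ z ∉ Γ n, truncPow f (κ n) 1 z * dx f z = 0 ∧ truncPow f (κ n) 1 z * dy f z = 0 := by
    intro z hz
    by_cases h1 : κ n < f z
    · have h2 : ¬ (dx f z ≠ 0 ∨ dy f z ≠ 0) := fun h => hz ⟨h1, h⟩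
      push Not at h2
      simp [h2]
    · simp [truncPow, max_eq_right (sub_nonpos.2 (not_lt.1 h1))]
  have hη0 := integral_sq_eq_zero_of_small hη.diff.continuous.memLp_box (hη.memLp_dx s t)
    (hη.memLp_dy s t) (sub_nonneg.2 hst)
    (caccioppoli hf hg hw hwx hwy hdiv hst heq (fun y => (hs y).trans (hκk n))
      (fun y => (ht y).trans (hκk n)) hδ hgs hgt
      (fun z hz => (hB₁ z hz).trans (le_max_left _ _))
      (fun z hz => (hB₂ z hz).trans (le_max_right _ _)))
    (integral_sq_le_of_eq_zero_left hη.diff hst (fun y => by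
      simp [truncPow, max_eq_right (sub_nonpos.2 ((hs y).trans (hκk n)))])
      (hη.memLp_dx s t) (hη.memLp_dy s t)) (hΓm n)
    (fun z hz => by rw [dx_truncPow hf.diff, mul_assoc, (hzero z hz).1, mul_zero])
    (fun z hz => by rw [dy_truncPow hf.diff, mul_assoc, (hzero z hz).2, mul_zero]) hn
  have hae : ∀ᵐ z ∂boxMeasure s t, f z ≤ κ n := by
    have := (integral_eq_zero_iff_of_nonneg (fun z => sq_nonneg _)
      (hη.diff.continuous.memLp_box (s := s) (t := t)).integrable_sq).1 hη0
    filter_upwards [this] with z hz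
    by_contra! h
    have h1 : 0 < truncPow f (κ n) 2 z := pow_pos (lt_max_of_lt_left (sub_pos.2 h)) 2
    exact (pow_pos h1 2).ne' hz
  have hz₀' := hlt_of z₀.1 hz₀.1 z₀.2 hM
  have hcl : z₀ ∈ closure (Set.Ioo s t ×ˢ Set.Ioo (0 : ℝ) 1) := by
    rw [closure_prod_eq, closure_Ioo (hz₀'.1.trans hz₀'.2).ne, closure_Ioo zero_ne_one]
    exact hz₀
  have hopen : IsOpen {z | κ n < f z} := isOpen_lt continuous_const hfc
  have hne := mem_closure_iff.1 hcl _ hopen (hκM n)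
  have hpos := (hopen.inter (isOpen_Ioo.prod isOpen_Ioo)).measure_pos volume hne
  refine hpos.ne' ?_
  rw [boxMeasure_eq, ae_restrict_iff' (measurableSet_Ioc.prod measurableSet_Ioc)] at hae
  refine measure_mono_null ?_ hae
  rintro z ⟨h1, h2⟩ h3
  exact absurd (h3 ⟨Set.Ioo_subset_Ioc_self h2.1, Set.Ioo_subset_Ioc_self h2.2⟩)
    (not_le.2 h1)

theorem abs_sub_integral_le {k k' : ℝ → ℝ} (hk : ∀ y, HasDerivAt k (k' y) y)
    (hp : ∀ y, k (y + 1) = k y) (hp' : ∀ y, k' (y + 1) = k' y) {δ : ℝ} (hδ : 0 ≤ δ)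
    (h : ∫⁻ y, ENNReal.ofReal (k' y ^ 2) ∂cellMeasure ≤ ENNReal.ofReal (δ ^ 2)) (y : ℝ) :
    |k y - ∫ y', k y' ∂cellMeasure| ≤ δ := by
  have h1 : ∀ y h, 0 ≤ h → h ≤ 1 → |k (y + h) - k y| ≤ δ := by
    intro y r hr0 hr1
    rcases hr0.eq_or_lt with rfl | hr
    · simpa using hδ
    have h2 := ofReal_sq_sub_le hk y hr
    have h3 : ∫⁻ s in Set.Ioc 0 r, ENNReal.ofReal (k' (y + s) ^ 2) ≤ ENNReal.ofReal (δ ^ 2) := by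
      refine (lintegral_mono_set (Set.Ioc_subset_Ioc_right hr1)).trans ?_
      have := lintegral_cell_shift (φ := fun y => ENNReal.ofReal (k' y ^ 2))
        (fun y => by rw [hp']) y
      simp only [add_comm _ y] at this
      exact this.trans_le h
    have h4 : ENNReal.ofReal ((k (y + r) - k y) ^ 2) ≤ ENNReal.ofReal (δ ^ 2) :=
      h2.trans ((mul_le_mul' (ENNReal.ofReal_le_one.2 hr1) h3).trans_eq (one_mul _))
    exact abs_le_of_sq_le_sq ((ENNReal.ofReal_le_ofReal_iff (sq_nonneg _)).1 h4) hδ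
  have h2 : ∀ y ∈ Set.Icc (0 : ℝ) 1, ∀ y' ∈ Set.Icc (0 : ℝ) 1, |k y - k y'| ≤ δ := by
    intro y hy y' hy'
    wlog hle : y' ≤ y generalizing y y'
    · rw [abs_sub_comm]; exact this y' hy' y hy (le_of_not_ge hle)
    have := h1 y' (y - y') (sub_nonneg.2 hle) (by linarith [hy.2, hy'.1])
    simpa using this
  obtain ⟨y₀, hy₀, he⟩ : ∃ y₀ ∈ Set.Icc (0 : ℝ) 1, k y = k y₀ := by
    refine ⟨Int.fract y, ⟨Int.fract_nonneg y, (Int.fract_lt_one y).le⟩, ?_⟩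
    have := Function.Periodic.sub_int_mul_eq (f := k) (c := 1) hp (x := y) ⌊y⌋
    simp only [mul_one] at this
    exact this.symm
  have hc : Continuous k := continuous_iff_continuousAt.2 fun y => (hk y).continuousAt
  have hki : Integrable k cellMeasure :=
    (hc.integrableOn_Icc (a := 0) (b := 1)).mono_set Set.Ioc_subset_Icc_self
  have h3 : k y₀ - ∫ y', k y' ∂cellMeasure = ∫ y', (k y₀ - k y') ∂cellMeasure := by
    rw [integral_sub (integrable_const _) hki]; simp
  rw [he, h3]
  have h4 : ∀ᵐ y' ∂cellMeasure, ‖k y₀ - k y'‖ ≤ δ := by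
    filter_upwards [ae_restrict_mem (measurableSet_Ioc (a := (0 : ℝ)) (b := 1))] with y' hm
    exact h2 _ hy₀ _ (Set.Ioc_subset_Icc_self hm)
  simpa using norm_integral_le_of_norm_le_const h4

/-- The slice `{x} × 𝕋` on which `(f, g)` is close to `(p, q)`, with small `∂₂ g`. -/
structure GoodSlice (f g : ℝ × ℝ → ℝ) (p q δ x : ℝ) : Prop where
  fst : ∀ y, |f (x, y) - p| ≤ δ
  snd : ∀ y, |g (x, y) - q| ≤ δ
  deriv : ∫⁻ y, ENNReal.ofReal (dy g (x, y) ^ 2) ∂cellMeasure ≤ ENNReal.ofReal (δ ^ 2)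

theorem GoodSlice.mono {f g : ℝ × ℝ → ℝ} {p q δ δ' x : ℝ} (h : GoodSlice f g p q δ x)
    (hδ : 0 ≤ δ) (hδ' : δ ≤ δ') : GoodSlice f g p q δ' x :=
  ⟨fun y => (h.fst y).trans hδ', fun y => (h.snd y).trans hδ',
    h.deriv.trans (ENNReal.ofReal_le_ofReal (pow_le_pow_left₀ hδ hδ' 2))⟩

theorem frequently_goodSlice {f g : ℝ × ℝ → ℝ} (hf : Differentiable ℝ f) (hg : Differentiable ℝ g)
    (hpf : PeriodicSnd f) (hpg : PeriodicSnd g)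
    (hfin : ∫⁻ z, ENNReal.ofReal (dy f z ^ 2 + dy g z ^ 2)
      ∂(volume : Measure ℝ).prod cellMeasure ≠ ∞)
    {l : Filter ℝ} (hl : ∀ S ∈ l, volume S = ∞) {p q : ℝ}
    (hp : Tendsto (fun x => ∫ y, f (x, y) ∂cellMeasure) l (𝓝 p))
    (hq : Tendsto (fun x => ∫ y, g (x, y) ∂cellMeasure) l (𝓝 q)) {δ : ℝ} (hδ : 0 < δ) :
    ∃ᶠ x in l, GoodSlice f g p q δ x := by
  have hfm := measurable_dy f
  have hgm := measurable_dy g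
  rw [lintegral_prod _ (by fun_prop)] at hfin
  set H : ℝ → ℝ≥0∞ := fun x => ∫⁻ y, ENNReal.ofReal (dy f (x, y) ^ 2 + dy g (x, y) ^ 2) ∂cellMeasure
  have hδ2 : 0 < δ / 2 := half_pos hδ
  have hHm : AEMeasurable H volume :=
    (Measurable.lintegral_prod_right' (f := fun z : ℝ × ℝ =>
      ENNReal.ofReal (dy f z ^ 2 + dy g z ^ 2)) (by fun_prop)).aemeasurable
  have hM := meas_ge_le_lintegral_div hHm (ε := ENNReal.ofReal ((δ / 2) ^ 2))
    (by simpa using hδ.ne') ENNReal.ofReal_ne_top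
  have hM' : volume {x | ENNReal.ofReal ((δ / 2) ^ 2) ≤ H x} < ∞ :=
    hM.trans_lt (ENNReal.div_lt_top hfin (by simpa using hδ.ne'))
  intro hcon
  have e1 := Metric.tendsto_nhds.1 hp _ hδ2
  have e2 := Metric.tendsto_nhds.1 hq _ hδ2
  have hS := hl _ ((hcon.and e1).and e2)
  refine hM'.ne (top_unique (hS.symm.le.trans (measure_mono ?_)))
  rintro x ⟨⟨h1, h2⟩, h3⟩
  by_contra hlt
  have hlt' : H x ≤ ENNReal.ofReal ((δ / 2) ^ 2) := (not_le.1 hlt).le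
  have hf' : ∫⁻ y, ENNReal.ofReal (dy f (x, y) ^ 2) ∂cellMeasure ≤ ENNReal.ofReal ((δ / 2) ^ 2) :=
    (lintegral_mono fun y => ENNReal.ofReal_le_ofReal
      (le_add_of_nonneg_right (sq_nonneg (dy g (x, y))))).trans hlt'
  have hg' : ∫⁻ y, ENNReal.ofReal (dy g (x, y) ^ 2) ∂cellMeasure ≤ ENNReal.ofReal ((δ / 2) ^ 2) :=
    (lintegral_mono fun y => ENNReal.ofReal_le_ofReal
      (le_add_of_nonneg_left (sq_nonneg (dy f (x, y))))).trans hlt'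
  refine h1 ⟨fun y => ?_, fun y => ?_, hg'.trans (ENNReal.ofReal_le_ofReal (by nlinarith))⟩
  · have := abs_sub_integral_le (hasDerivAt_slice_snd hf x) (hpf x) (hpf.dy x) hδ2.le hf' y
    have h4 := abs_sub_le (f (x, y)) (∫ y, f (x, y) ∂cellMeasure) p
    rw [Real.dist_eq] at h2
    linarith
  · have := abs_sub_integral_le (hasDerivAt_slice_snd hg x) (hpg x) (hpg.dy x) hδ2.le hg' y
    have h4 := abs_sub_le (g (x, y)) (∫ y, g (x, y) ∂cellMeasure) q
    rw [Real.dist_eq] at h3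
    linarith

theorem volume_eq_top_of_mem_atTop {S : Set ℝ} (hS : S ∈ (atTop : Filter ℝ)) : volume S = ∞ := by
  obtain ⟨a, ha⟩ := mem_atTop_sets.1 hS
  exact top_unique (Real.volume_Ici.symm.le.trans (measure_mono (s := Set.Ici a) ha))

theorem volume_eq_top_of_mem_atBot {S : Set ℝ} (hS : S ∈ (atBot : Filter ℝ)) : volume S = ∞ := by
  obtain ⟨a, ha⟩ := mem_atBot_sets.1 hS
  exact top_unique (Real.volume_Iic.symm.le.trans (measure_mono (s := Set.Iic a) ha))

theorem exists_potential {P Q : ℝ × ℝ → ℝ} (hP : Differentiable ℝ P) (hQ : Differentiable ℝ Q)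
    (hPQ : ∀ z, dy P z = dx Q z) :
    ∃ F : ℝ × ℝ → ℝ, Differentiable ℝ F ∧ (∀ z, dx F z = P z) ∧ ∀ z, dy F z = Q z := by
  set ω : ℝ × ℝ → ℝ × ℝ →L[ℝ] ℝ := fun z =>
    P z • ContinuousLinearMap.fst ℝ ℝ ℝ + Q z • ContinuousLinearMap.snd ℝ ℝ ℝ with hω
  have hd : ∀ z, HasFDerivAt ω ((fderiv ℝ P z).smulRight (ContinuousLinearMap.fst ℝ ℝ ℝ)
      + (fderiv ℝ Q z).smulRight (ContinuousLinearMap.snd ℝ ℝ ℝ)) z := fun z =>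
    ((hP z).hasFDerivAt.smul_const (ContinuousLinearMap.fst ℝ ℝ ℝ)).add
      ((hQ z).hasFDerivAt.smul_const (ContinuousLinearMap.snd ℝ ℝ ℝ))
  obtain ⟨F, hF⟩ := convex_univ.exists_forall_hasFDerivAt_of_fderiv_symmetric (𝕜 := ℝ) (ω := ω)
    isOpen_univ (fun z _ => (hd z).differentiableAt.differentiableWithinAt) (fun z _ v v' => by
      rw [(hd z).fderiv]
      simp only [add_apply, ContinuousLinearMap.smulRight_apply,
        smul_apply, smul_eq_mul, ContinuousLinearMap.coe_fst',
        ContinuousLinearMap.coe_snd']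
      simp only [fderiv_eq_dx_dy P, fderiv_eq_dx_dy Q, hPQ z]
      ring)
  refine ⟨F, fun z => (hF z trivial).differentiableAt, fun z => ?_, fun z => ?_⟩
  · rw [dx, (hF z trivial).fderiv]; simp [hω]
  · rw [dy, (hF z trivial).fderiv]; simp [hω]

/-- The calibrating field: a pair `Φ` whose divergence along a solenoidal field `(f, g)` is
`w(f, g) (∂₁ g + ε ∂₂ f)`. -/
theorem exists_calibration {w : ℝ × ℝ → ℝ} (hw : Differentiable ℝ w) (hwx : Differentiable ℝ (dx w))
    (hwy : Differentiable ℝ (dy w)) {ε : ℝ} (hε : ∀ z, dx (dx w) z = ε * dy (dy w) z) :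
    ∃ α Φ₀ Φ₁ : ℝ × ℝ → ℝ, Differentiable ℝ α ∧ Differentiable ℝ Φ₀ ∧ Differentiable ℝ Φ₁ ∧
      (∀ z, dx Φ₀ z = α z) ∧ (∀ z, dy Φ₀ z = w z) ∧
      (∀ z, dx Φ₁ z = ε * w z) ∧ ∀ z, dy Φ₁ z = α z := by
  have hmul : ∀ (F : ℝ × ℝ → ℝ), Differentiable ℝ F → ∀ z,
      fderiv ℝ (fun z => ε * F z) z = ε • fderiv ℝ F z := fun F hF z =>
    ((hF z).hasFDerivAt.const_mul ε).fderiv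
  obtain ⟨α, hα, hαx, hαy⟩ := exists_potential (hwy.const_mul ε) hwx (fun z => by
    rw [hε z, dy, hmul _ hwy]; simp [dy])
  obtain ⟨Φ₀, h0, h0x, h0y⟩ := exists_potential hα hw hαy
  obtain ⟨Φ₁, h1, h1x, h1y⟩ := exists_potential (hw.const_mul ε) hα (fun z => by
    rw [hαx z, dy, hmul _ hw]; simp [dy])
  exact ⟨α, Φ₀, Φ₁, hα, h0, h1, h0x, h0y, h1x, h1y⟩

/-- Energy density of the field `(f, g)` for the potential `½ w²`. -/
def fieldDensity (w f g : ℝ × ℝ → ℝ) (z : ℝ × ℝ) : ℝ :=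
  1 / 2 * (dx f z ^ 2 + dy f z ^ 2 + dx g z ^ 2 + dy g z ^ 2) + 1 / 2 * w (f z, g z) ^ 2

/-- Defect of the field `(f, g)` from saturating the calibration. -/
def calibrationDefect (ε : ℝ) (w f g : ℝ × ℝ → ℝ) (z : ℝ × ℝ) : ℝ :=
  1 / 2 * (dx g z + ε * dy f z - w (f z, g z)) ^ 2 + (1 + ε) * dx f z ^ 2

theorem integral_calibrationDefect_le {w f g α Φ₀ Φ₁ : ℝ × ℝ → ℝ} (hf : PeriodicSobolev f)
    (hg : PeriodicSobolev g) (hdiv : ∀ z, dy g z = -dx f z) (hw : Continuous w) {ε : ℝ}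
    (hε : ε ^ 2 = 1) (hα : Continuous α) (h0 : Differentiable ℝ Φ₀) (h1 : Differentiable ℝ Φ₁)
    (h0x : ∀ z, dx Φ₀ z = α z) (h0y : ∀ z, dy Φ₀ z = w z) (h1x : ∀ z, dx Φ₁ z = ε * w z)
    (h1y : ∀ z, dy Φ₁ z = α z) {s t : ℝ} (hst : s ≤ t) {C δ : ℝ} (hδ : 0 ≤ δ)
    (hCs : ∀ y, |f (s, y)| ≤ C) (hCt : ∀ y, |f (t, y)| ≤ C)
    (hs : ∫⁻ y, ENNReal.ofReal (dy g (s, y) ^ 2) ∂cellMeasure ≤ ENNReal.ofReal (δ ^ 2))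
    (ht : ∫⁻ y, ENNReal.ofReal (dy g (t, y) ^ 2) ∂cellMeasure ≤ ENNReal.ofReal (δ ^ 2)) :
    Integrable (calibrationDefect ε w f g) (boxMeasure s t) ∧
    ∫ z, calibrationDefect ε w f g z ∂boxMeasure s t ≤
      ∫ z, fieldDensity w f g z ∂boxMeasure s t
        - ∫ y, (Φ₀ (f (t, y), g (t, y)) - Φ₀ (f (s, y), g (s, y))) ∂cellMeasure + 2 * C * δ := by
  have hfg : Continuous fun z => (f z, g z) := hf.diff.continuous.prodMk hg.diff.continuous
  have hwc : Continuous fun z => w (f z, g z) := hw.comp hfg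
  have hαc : Continuous fun z => α (f z, g z) := hα.comp hfg
  have fx := hf.memLp_dx s t
  have fy := hf.memLp_dy s t
  have gx := hg.memLp_dx s t
  have gy := hg.memLp_dy s t
  have hwL : MemLp (fun z => w (f z, g z)) 2 (boxMeasure s t) := hwc.memLp_box
  have iE : Integrable (fieldDensity w f g) (boxMeasure s t) :=
    ((((fx.integrable_sq.add fy.integrable_sq).add gx.integrable_sq).add
      gy.integrable_sq).const_mul _).add (hwL.integrable_sq.const_mul _)
  have iJ : Integrable (fun z => dx f z * dy g z - dy f z * dx g z) (boxMeasure s t) :=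
    (fx.integrable_mul gy).sub (fy.integrable_mul gx)
  have d0 : ∀ z, dx (fun z => Φ₀ (f z, g z)) z
      = dx f z * α (f z, g z) + dx g z * w (f z, g z) := fun z => by
    rw [dx_comp_prodMk h0 hf.diff hg.diff, h0x, h0y]
  have d1 : ∀ z, dy (fun z => Φ₁ (f z, g z)) z
      = dy f z * (ε * w (f z, g z)) + dy g z * α (f z, g z) := fun z => by
    rw [dy_comp_prodMk h1 hf.diff hg.diff, h1x, h1y]
  have i0 : Integrable (dx fun z => Φ₀ (f z, g z)) (boxMeasure s t) := by
    refine (((MemLp.continuous_mul hαc fx).add (MemLp.continuous_mul hwc gx)).integrable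
      one_le_two).congr (Eventually.of_forall fun z => ?_)
    simp only [d0, Pi.add_apply]; ring
  have i1 : Integrable (dy fun z => Φ₁ (f z, g z)) (boxMeasure s t) := by
    refine (((MemLp.continuous_mul (hwc.const_mul ε) fy).add
      (MemLp.continuous_mul hαc gy)).integrable one_le_two).congr (Eventually.of_forall fun z => ?_)
    simp only [d1, Pi.add_apply]; ring
  have e0 := integral_dx (F := fun z => Φ₀ (f z, g z))
    (fun z => (hasFDerivAt_comp_prodMk h0 hf.diff hg.diff z).differentiableAt) hst i0
  have e1 := integral_dy (F := fun z => Φ₁ (f z, g z))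
    (fun z => (hasFDerivAt_comp_prodMk h1 hf.diff hg.diff z).differentiableAt)
    (fun x y => by simp only [hf.per x y, hg.per x y]) i1
  have eJ := abs_integral_det_le hf.diff hg.diff hf.per hg.per hst fx fy gx gy hδ hCs hCt hs ht
  have hD : calibrationDefect ε w f g = fun z => fieldDensity w f g z
      - (dx (fun z => Φ₀ (f z, g z)) z + dy (fun z => Φ₁ (f z, g z)) z)
      - ε * (dx f z * dy g z - dy f z * dx g z) := by
    funext z
    rw [d0, d1, calibrationDefect, fieldDensity, hdiv z]
    linear_combination (1 / 2 * dy f z ^ 2) * hε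
  have iD := (iE.sub (i0.add i1)).sub (iJ.const_mul ε)
  rw [hD]
  refine ⟨iD, ?_⟩
  have : ∫ z, (fieldDensity w f g z
      - (dx (fun z => Φ₀ (f z, g z)) z + dy (fun z => Φ₁ (f z, g z)) z)
      - ε * (dx f z * dy g z - dy f z * dx g z)) ∂boxMeasure s t
      = ∫ z, fieldDensity w f g z ∂boxMeasure s t
        - (∫ z, dx (fun z => Φ₀ (f z, g z)) z ∂boxMeasure s t
          + ∫ z, dy (fun z => Φ₁ (f z, g z)) z ∂boxMeasure s t)
        - ε * ∫ z, (dx f z * dy g z - dy f z * dx g z) ∂boxMeasure s t := by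
    refine (integral_sub' (iE.sub (i0.add i1)) (iJ.const_mul ε)).trans ?_
    rw [integral_sub' iE (i0.add i1), integral_add' i0 i1, integral_const_mul]
  rw [this, e0, e1]
  have hεJ : |ε * ∫ z, (dx f z * dy g z - dy f z * dx g z) ∂boxMeasure s t| ≤ 2 * C * δ := by
    rwa [abs_mul, (by nlinarith [sq_abs ε, abs_nonneg ε] : |ε| = 1), one_mul]
  have := neg_abs_le (ε * ∫ z, (dx f z * dy g z - dy f z * dx g z) ∂boxMeasure s t)
  linarith

theorem boxMeasure_mono {s s' t t' : ℝ} (hs : s ≤ s') (ht : t' ≤ t) :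
    boxMeasure s' t' ≤ boxMeasure s t := by
  rw [boxMeasure_eq, boxMeasure_eq]
  exact Measure.restrict_mono (Set.prod_mono (Set.Ioc_subset_Ioc hs ht) le_rfl) le_rfl

theorem exists_forall_abs_sub_le {Φ : ℝ × ℝ → ℝ} (hΦ : Continuous Φ) (p q : ℝ) {η : ℝ}
    (hη : 0 < η) : ∃ δ > 0, ∀ x y, |x - p| ≤ δ → |y - q| ≤ δ → |Φ (x, y) - Φ (p, q)| ≤ η := by
  obtain ⟨δ, hδ, h⟩ := Metric.continuousAt_iff.1 (hΦ.continuousAt (x := (p, q))) η hη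
  refine ⟨δ / 2, half_pos hδ, fun x y hx hy => ?_⟩
  have h1 : dist (x, y) (p, q) < δ := by
    rw [Prod.dist_eq]
    exact max_lt (by rw [Real.dist_eq]; linarith) (by rw [Real.dist_eq]; linarith)
  have := h h1
  rw [Real.dist_eq] at this
  exact this.le

theorem calibrationDefect_ae_eq_zero {w f g α Φ₀ Φ₁ : ℝ × ℝ → ℝ} (hf : PeriodicSobolev f)
    (hg : PeriodicSobolev g) (hdiv : ∀ z, dy g z = -dx f z) (hw : Continuous w) {ε : ℝ}
    (hε : ε ^ 2 = 1) (hα : Continuous α) (h0 : Differentiable ℝ Φ₀) (h1 : Differentiable ℝ Φ₁)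
    (h0x : ∀ z, dx Φ₀ z = α z) (h0y : ∀ z, dy Φ₀ z = w z) (h1x : ∀ z, dx Φ₁ z = ε * w z)
    (h1y : ∀ z, dy Φ₁ z = α z) {p qm qp : ℝ}
    (hbot : ∀ δ > 0, ∃ᶠ x in atBot, GoodSlice f g p qm δ x)
    (htop : ∀ δ > 0, ∃ᶠ x in atTop, GoodSlice f g p qp δ x)
    (hE : ∀ s t, ∫ z, fieldDensity w f g z ∂boxMeasure s t ≤ Φ₀ (p, qp) - Φ₀ (p, qm)) (R : ℝ) :
    ∀ᵐ z ∂boxMeasure (-R) R, dx g z + ε * dy f z = w (f z, g z) ∧ (1 + ε) * dx f z ^ 2 = 0 := by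
  have hε1 : 0 ≤ 1 + ε := by nlinarith
  have hnn : ∀ z, 0 ≤ calibrationDefect ε w f g z := fun z => by
    have := mul_nonneg hε1 (sq_nonneg (dx f z))
    unfold calibrationDefect; positivity
  have key : ∀ η > 0, Integrable (calibrationDefect ε w f g) (boxMeasure (-R) R) ∧
      ∫ z, calibrationDefect ε w f g z ∂boxMeasure (-R) R ≤ 0 + η := by
    intro η hη
    obtain ⟨δ₁, hδ₁, k1⟩ := exists_forall_abs_sub_le h0.continuous p qp (η := η / 3) (by positivity)
    obtain ⟨δ₂, hδ₂, k2⟩ := exists_forall_abs_sub_le h0.continuous p qm (η := η / 3) (by positivity)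
    set δ := min (min δ₁ δ₂) (min 1 (η / (6 * (|p| + 1)))) with hδdef
    have hp : 0 < |p| + 1 := by positivity
    have hδ : 0 < δ := by positivity
    have hδ1 : δ ≤ 1 := (min_le_right _ _).trans (min_le_left _ _)
    have hδη : 2 * (|p| + 1) * δ ≤ η / 3 := by
      have : δ ≤ η / (6 * (|p| + 1)) := (min_le_right _ _).trans (min_le_right _ _)
      rw [le_div_iff₀ (by positivity)] at this
      linarith
    obtain ⟨s, hs, hsR⟩ := ((hbot δ hδ).and_eventually (eventually_le_atBot (min (-R) 0))).exists
    obtain ⟨t, ht, htR⟩ := ((htop δ hδ).and_eventually (eventually_ge_atTop (max R 0))).exists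
    have hbd : ∀ {q x : ℝ}, GoodSlice f g p q δ x → ∀ y, |f (x, y)| ≤ |p| + 1 := fun {_ x} hx y => by
      have := abs_sub_abs_le_abs_sub (f (x, y)) p
      linarith [hx.fst y]
    have hfg : Continuous fun z => (f z, g z) := hf.diff.continuous.prodMk hg.diff.continuous
    obtain ⟨iD, hD⟩ := integral_calibrationDefect_le hf hg hdiv hw hε hα h0 h1 h0x h0y h1x h1y
      (hsR.trans ((min_le_right _ _).trans ((le_max_right _ _).trans htR))) hδ.le
      (hbd hs) (hbd ht) hs.deriv ht.deriv
    have hbox := boxMeasure_mono (hsR.trans (min_le_left _ _)) ((le_max_left _ _).trans htR)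
    refine ⟨iD.mono_measure hbox, (integral_mono_measure hbox
      (Eventually.of_forall hnn) iD).trans ?_⟩
    have iΦ : ∀ x, Integrable (fun y => Φ₀ (f (x, y), g (x, y))) cellMeasure := fun x =>
      ((h0.continuous.comp (hfg.comp (by fun_prop : Continuous fun y : ℝ => (x, y)))).integrableOn_Icc
        (a := 0) (b := 1)).mono_set Set.Ioc_subset_Icc_self
    have hΦ : Φ₀ (p, qp) - Φ₀ (p, qm) - 2 * (η / 3) ≤
        ∫ y, (Φ₀ (f (t, y), g (t, y)) - Φ₀ (f (s, y), g (s, y))) ∂cellMeasure := by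
      have := integral_mono (μ := cellMeasure)
        (integrable_const (Φ₀ (p, qp) - Φ₀ (p, qm) - 2 * (η / 3))) ((iΦ t).sub (iΦ s)) (fun y => by
          have hd1 : δ ≤ δ₁ := (min_le_left _ _).trans (min_le_left _ _)
          have hd2 : δ ≤ δ₂ := (min_le_left _ _).trans (min_le_right _ _)
          have a1 := abs_le.1 (k1 _ _ ((ht.fst y).trans hd1) ((ht.snd y).trans hd1))
          have a2 := abs_le.1 (k2 _ _ ((hs.fst y).trans hd2) ((hs.snd y).trans hd2))
          simp only [Pi.sub_apply]
          linarith [a1.1, a2.2])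
      simpa using this
    linarith [hE s t]
  have h_int := (key 1 one_pos).1
  have hzero : ∫ z, calibrationDefect ε w f g z ∂boxMeasure (-R) R = 0 :=
    le_antisymm (le_of_forall_pos_le_add fun η hη => (key η hη).2) (integral_nonneg hnn)
  filter_upwards [(integral_eq_zero_iff_of_nonneg hnn h_int).1 hzero] with z hz
  have h2 := mul_nonneg hε1 (sq_nonneg (dx f z))
  simp only [calibrationDefect, Pi.zero_apply] at hz
  have h3 := sq_nonneg (dx g z + ε * dy f z - w (f z, g z))
  refine ⟨?_, by linarith⟩
  have h4 : (dx g z + ε * dy f z - w (f z, g z)) ^ 2 = 0 := by linarith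
  linarith [pow_eq_zero_iff (two_ne_zero) |>.1 h4]

theorem ae_strip_of_forall_box {P : ℝ × ℝ → Prop}
    (h : ∀ R : ℝ, ∀ᵐ z ∂boxMeasure (-R) R, P z) :
    ∀ᵐ z ∂(volume : Measure ℝ).prod cellMeasure, P z := by
  have e : (volume : Measure ℝ).prod cellMeasure
      = volume.restrict (⋃ n : ℕ, Set.Ioc (-(n : ℝ)) n ×ˢ Set.Ioc (0 : ℝ) 1) := by
    have hu : (⋃ n : ℕ, Set.Ioc (-(n : ℝ)) n) = Set.univ := by
      refine Set.eq_univ_of_forall fun x => ?_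
      obtain ⟨n, hn⟩ := exists_nat_gt |x|
      exact Set.mem_iUnion.2 ⟨n, (abs_lt.1 hn).1, (abs_lt.1 hn).2.le⟩
    rw [← Set.iUnion_prod_const, hu, Measure.volume_eq_prod, ← Measure.prod_restrict,
      Measure.restrict_univ, cellMeasure]
  rw [e, ae_restrict_iUnion_iff]
  intro n
  simpa only [boxMeasure_eq] using h n

theorem eq_const_of_dx_ae_eq_zero {f : ℝ × ℝ → ℝ} (hf : PeriodicSobolev f)
    (h : ∀ᵐ z ∂(volume : Measure ℝ).prod cellMeasure, dx f z = 0) (s t y : ℝ) :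
    f (s, y) = f (t, y) := by
  have h1 : ∀ᵐ y ∂cellMeasure, ∀ᵐ x ∂(volume : Measure ℝ), dx f (x, y) = 0 :=
    Measure.ae_ae_of_ae_prod
      ((Measure.measurePreserving_swap (μ := cellMeasure) (ν := (volume : Measure ℝ))).quasiMeasurePreserving.ae h)
  have h2 : ∀ᵐ y ∂cellMeasure, f (s, y) = f (t, y) := by
    filter_upwards [h1] with y hy
    have hd : ∀ x, HasDerivAt (fun x => f (x, y)) 0 x :=
      hasDerivAt_of_ae_eq (c := fun _ => 0) (fun x => hasDerivAt_slice_fst hf.diff x y)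
        continuous_const hy
    exact is_const_of_deriv_eq_zero (fun x => (hd x).differentiableAt) (fun x => (hd x).deriv) s t
  obtain ⟨y', hy', e⟩ := hf.per.exists_mem_Icc y
  rw [e, e]
  rw [cellMeasure, restrict_Ioc_eq_restrict_Icc] at h2
  have hc := hf.diff.continuous
  exact Measure.eqOn_Icc_of_ae_eq (volume : Measure ℝ) zero_ne_one h2
    (by fun_prop : Continuous fun y => f (s, y)).continuousOn
    (by fun_prop : Continuous fun y => f (t, y)).continuousOn hy'

/-- If `(f, g)` saturates the calibration inequality and connects two points of the line
`{z₁ = p}`, then it is one-dimensional and solves the first order equation. -/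
theorem exists_profile {w f g : ℝ × ℝ → ℝ} (hf : PeriodicSobolev f) (hg : PeriodicSobolev g)
    (hdiv : ∀ z, dy g z = -dx f z) (hw : Differentiable ℝ w) (hwx : Continuous (dx w))
    (hwy : Continuous (dy w)) {ε : ℝ} (hε : ε = 1 ∨ ε = -1) {p qm qp : ℝ}
    (hbot : ∀ δ > 0, ∃ᶠ x in atBot, GoodSlice f g p qm δ x)
    (htop : ∀ δ > 0, ∃ᶠ x in atTop, GoodSlice f g p qp δ x)
    (hae : ∀ R, ∀ᵐ z ∂boxMeasure (-R) R,
      dx g z + ε * dy f z = w (f z, g z) ∧ (1 + ε) * dx f z ^ 2 = 0) :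
    ∃ γ : ℝ → ℝ, (∀ z, f z = p ∧ g z = γ z.1) ∧ ∀ t, HasDerivAt γ (w (p, γ t)) t := by
  have hfp : ∀ z, f z = p := by
    rcases hε with rfl | rfl
    · have h0 := ae_strip_of_forall_box fun R => (hae R).mono fun z hz =>
        (by simpa using hz.2 : dx f z = 0)
      rintro ⟨x, y⟩
      refine sub_eq_zero.1 (abs_eq_zero.1 (le_antisymm (le_of_forall_pos_le_add fun δ hδ => ?_)
        (abs_nonneg _)))
      obtain ⟨s, hs⟩ := (htop δ hδ).exists
      rw [eq_const_of_dx_ae_eq_zero hf h0 x s y, zero_add]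
      exact hs.fst y
    · have hbox : ∀ s t, ∀ᵐ z ∂boxMeasure s t, dx g z - dy f z = w (f z, g z) := fun s t => by
        have := hae (max |s| |t|)
        refine Eventually.mono (ae_mono (boxMeasure_mono ?_ ?_) this) fun z hz => by linarith [hz.1]
        · linarith [neg_abs_le s, le_max_left |s| |t|]
        · exact (le_abs_self t).trans (le_max_right _ _)
      have hle : ∀ δ > 0, ∀ x y, f (x, y) ≤ p + δ ∧ -f (x, y) ≤ -p + δ := fun δ hδ x y => by
        obtain ⟨s, hs, hsx⟩ := ((hbot δ hδ).and_eventually (eventually_le_atBot x)).exists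
        obtain ⟨t, ht, hxt⟩ := ((htop δ hδ).and_eventually (eventually_ge_atTop x)).exists
        constructor
        · exact le_of_elliptic hf hg hw hwx hwy hdiv (hsx.trans hxt) (hbox s t)
            (fun y => by linarith [(abs_le.1 (hs.fst y)).2])
            (fun y => by linarith [(abs_le.1 (ht.fst y)).2]) hδ.le hs.deriv ht.deriv x ⟨hsx, hxt⟩ y
        · have nx : ∀ (F : ℝ × ℝ → ℝ) z, dx (fun z => -F z) z = -dx F z := fun F z => by
            simp [dx, fderiv_fun_neg]
          have ny : ∀ (F : ℝ × ℝ → ℝ) z, dy (fun z => -F z) z = -dy F z := fun F z => by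
            simp [dy, fderiv_fun_neg]
          have wd : ∀ z, HasFDerivAt (fun z => -w (-z)) (fderiv ℝ w (-z)) z := fun z => by
            have := ((hw (-z)).hasFDerivAt.comp z (hasFDerivAt_id z).neg).neg
            exact this.congr_fderiv (by ext <;> simp)
          have wx : dx (fun z => -w (-z)) = fun z => dx w (-z) := by
            funext z; rw [dx, (wd z).fderiv]; rfl
          have wy : dy (fun z => -w (-z)) = fun z => dy w (-z) := by
            funext z; rw [dy, (wd z).fderiv]; rfl
          refine le_of_elliptic hf.neg hg.neg (w := fun z => -w (-z))
            (fun z => (wd z).differentiableAt) (by rw [wx]; fun_prop) (by rw [wy]; fun_prop)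
            (fun z => by rw [nx, ny, hdiv]) (hsx.trans hxt)
            ((hbox s t).mono fun z hz => ?_)
            (fun y => by linarith [(abs_le.1 (hs.fst y)).1])
            (fun y => by linarith [(abs_le.1 (ht.fst y)).1]) hδ.le ?_ ?_ x ⟨hsx, hxt⟩ y
          · rw [nx, ny]
            simp only [Prod.neg_mk, neg_neg]
            linarith
          · simpa only [ny, neg_sq] using hs.deriv
          · simpa only [ny, neg_sq] using ht.deriv
      rintro ⟨x, y⟩
      refine le_antisymm (le_of_forall_pos_le_add fun δ hδ => (hle δ hδ x y).1)
        (le_of_forall_pos_le_add fun δ hδ => by linarith [(hle δ hδ x y).2])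
  have hfc : f = fun _ => p := funext hfp
  have hdxf : ∀ z, dx f z = 0 := fun z => by rw [hfc]; simp [dx]
  have hdyf : ∀ z, dy f z = 0 := fun z => by rw [hfc]; simp [dy]
  have hgy : ∀ x y, g (x, y) = g (x, 0) := fun x y => by
    have hd : ∀ y, HasDerivAt (fun y => g (x, y)) 0 y := fun y => by
      simpa [hdiv, hdxf] using hasDerivAt_slice_snd hg.diff x y
    exact is_const_of_deriv_eq_zero (fun y => (hd y).differentiableAt) (fun y => (hd y).deriv) y 0
  refine ⟨fun x => g (x, 0), fun z => ⟨hfp z, hgy z.1 z.2⟩, ?_⟩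
  have hgd : ∀ x y, dx g (x, y) = dx g (x, 0) := fun x y => by
    have h1 := hasDerivAt_slice_fst hg.diff x y
    simp only [hgy] at h1
    exact h1.unique (hasDerivAt_slice_fst hg.diff x 0)
  have hae' := Measure.ae_ae_of_ae_prod (ae_strip_of_forall_box fun R => (hae R).mono fun z hz => hz.1)
  have hgc := hg.diff.continuous
  have hwc := hw.continuous
  refine hasDerivAt_of_ae_eq (fun x => hasDerivAt_slice_fst hg.diff x 0) (by fun_prop) ?_
  filter_upwards [hae'] with x hx
  obtain ⟨y, hy⟩ := hx.exists
  rw [hgd, hdyf, hfp, hgy] at hy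
  simpa using hy

theorem surjective_primitive_inv {ω T : ℝ → ℝ} (hω : ContDiff ℝ 1 ω) {m q : ℝ} (hmq : m < q)
    (hm : ω m = 0) (hq : ω q = 0) (hpos : ∀ s ∈ Set.Ioo m q, 0 < ω s)
    (hT : ∀ s ∈ Set.Ioo m q, HasDerivAt T (ω s)⁻¹ s) : Set.SurjOn T (Set.Ioo m q) Set.univ := by
  obtain ⟨K, hK⟩ := (hω.contDiffOn (s := Set.Icc m q)).exists_lipschitzOnWith one_ne_zero
    (convex_Icc m q) isCompact_Icc
  set L : ℝ := K + 1
  have hL : 0 < L := by positivity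
  have hqmem := Set.right_mem_Icc.2 hmq.le
  have hmmem := Set.left_mem_Icc.2 hmq.le
  have bq : ∀ s ∈ Set.Ioo m q, ω s ≤ L * (q - s) := fun s hs => by
    have := hK.dist_le_mul s (Set.Ioo_subset_Icc_self hs) q hqmem
    rw [Real.dist_eq, Real.dist_eq, hq, sub_zero, abs_of_pos (hpos s hs), abs_sub_comm,
      abs_of_pos (sub_pos.2 hs.2)] at this
    nlinarith [hs.2]
  have bm : ∀ s ∈ Set.Ioo m q, ω s ≤ L * (s - m) := fun s hs => by
    have := hK.dist_le_mul s (Set.Ioo_subset_Icc_self hs) m hmmem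
    rw [Real.dist_eq, Real.dist_eq, hm, sub_zero, abs_of_pos (hpos s hs),
      abs_of_pos (sub_pos.2 hs.1)] at this
    nlinarith [hs.1]
  have hcont : ContinuousOn T (Set.Ioo m q) := fun s hs => (hT s hs).continuousAt.continuousWithinAt
  obtain ⟨c, hc⟩ := Set.nonempty_Ioo.2 hmq
  have mono1 : MonotoneOn (fun s => T s + L⁻¹ * Real.log (q - s)) (Set.Ioo m q) := by
    have hd : ∀ s ∈ Set.Ioo m q,
        HasDerivAt (fun s => T s + L⁻¹ * Real.log (q - s)) ((ω s)⁻¹ + L⁻¹ * (-1 / (q - s))) s :=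
      fun s hs => (hT s hs).add
        ((((hasDerivAt_id s).const_sub q).log (sub_pos.2 hs.2).ne').const_mul _)
    refine monotoneOn_of_deriv_nonneg (convex_Ioo m q)
      (fun s hs => (hd s hs).continuousAt.continuousWithinAt) ?_ ?_
    · rw [interior_Ioo]
      exact fun s hs => (hd s hs).differentiableAt.differentiableWithinAt
    · rw [interior_Ioo]
      intro s hs
      rw [(hd s hs).deriv]
      have h1 : (L * (q - s))⁻¹ ≤ (ω s)⁻¹ := inv_anti₀ (hpos s hs) (bq s hs)
      have h2 : L⁻¹ * (-1 / (q - s)) = -(L * (q - s))⁻¹ := by rw [mul_inv]; ring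
      linarith
  have mono2 : MonotoneOn (fun s => T s - L⁻¹ * Real.log (s - m)) (Set.Ioo m q) := by
    have hd : ∀ s ∈ Set.Ioo m q,
        HasDerivAt (fun s => T s - L⁻¹ * Real.log (s - m)) ((ω s)⁻¹ - L⁻¹ * (1 / (s - m))) s :=
      fun s hs => (hT s hs).sub
        ((((hasDerivAt_id s).sub_const m).log (sub_pos.2 hs.1).ne').const_mul _)
    refine monotoneOn_of_deriv_nonneg (convex_Ioo m q)
      (fun s hs => (hd s hs).continuousAt.continuousWithinAt) ?_ ?_
    · rw [interior_Ioo]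
      exact fun s hs => (hd s hs).differentiableAt.differentiableWithinAt
    · rw [interior_Ioo]
      intro s hs
      rw [(hd s hs).deriv]
      have h1 : (L * (s - m))⁻¹ ≤ (ω s)⁻¹ := inv_anti₀ (hpos s hs) (bm s hs)
      have h2 : L⁻¹ * (1 / (s - m)) = (L * (s - m))⁻¹ := by rw [mul_inv]; ring
      linarith
  have ltop : Tendsto T (𝓝[<] q) atTop := by
    have h0 : Tendsto (fun s : ℝ => q - s) (𝓝[<] q) (𝓝[>] 0) := by
      refine tendsto_nhdsWithin_iff.2 ⟨?_, ?_⟩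
      · have : ContinuousAt (fun s : ℝ => q - s) q := by fun_prop
        simpa using this.tendsto.mono_left nhdsWithin_le_nhds
      · exact eventually_mem_nhdsWithin.mono fun s hs => sub_pos.2 (Set.mem_Iio.1 hs)
    have h1 := tendsto_neg_atBot_atTop.comp
      ((Real.tendsto_log_nhdsGT_zero.comp h0).const_mul_atBot (inv_pos.2 hL))
    refine tendsto_atTop_mono' _ ?_ (tendsto_atTop_add_const_left _ (T c + L⁻¹ * Real.log (q - c)) h1)
    filter_upwards [Ioo_mem_nhdsLT hc.2] with s hs
    have := mono1 hc ⟨hc.1.trans hs.1, hs.2⟩ hs.1.le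
    simp only [Function.comp] at this ⊢
    linarith
  have lbot : Tendsto T (𝓝[>] m) atBot := by
    have h0 : Tendsto (fun s : ℝ => s - m) (𝓝[>] m) (𝓝[>] 0) := by
      refine tendsto_nhdsWithin_iff.2 ⟨?_, ?_⟩
      · have : ContinuousAt (fun s : ℝ => s - m) m := by fun_prop
        simpa using this.tendsto.mono_left nhdsWithin_le_nhds
      · exact eventually_mem_nhdsWithin.mono fun s hs => sub_pos.2 (Set.mem_Ioi.1 hs)
    have h1 := (Real.tendsto_log_nhdsGT_zero.comp h0).const_mul_atBot (inv_pos.2 hL)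
    refine tendsto_atBot_mono' _ ?_ (tendsto_atBot_add_const_left _ (T c - L⁻¹ * Real.log (c - m)) h1)
    filter_upwards [Ioo_mem_nhdsGT hc.1] with s hs
    have := mono2 ⟨hs.1, hs.2.trans hc.2⟩ hc hs.2.le
    simp only [Function.comp] at this ⊢
    linarith
  refine hcont.surjOn_of_tendsto ⟨c, hc⟩ ?_ ?_
  · exact lbot.comp ((map_coe_Ioo_atBot hmq).le)
  · exact ltop.comp ((map_coe_Ioo_atTop hmq).le)

theorem exists_heteroclinic_of_lt {ω : ℝ → ℝ} (hω : ContDiff ℝ 1 ω) {m q : ℝ} (hmq : m < q)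
    (hm : ω m = 0) (hq : ω q = 0) (hpos : ∀ s ∈ Set.Ioo m q, 0 < ω s) :
    ∃ h : ℝ → ℝ, (∀ t, HasDerivAt h (ω (h t)) t) ∧ Tendsto h atBot (𝓝 m) ∧
      Tendsto h atTop (𝓝 q) := by
  obtain ⟨c, hc⟩ := Set.nonempty_Ioo.2 hmq
  set T : ℝ → ℝ := fun s => ∫ r in c..s, (ω r)⁻¹
  have hinv : ContinuousOn (fun r => (ω r)⁻¹) (Set.Ioo m q) :=
    hω.continuous.continuousOn.inv₀ fun s hs => (hpos s hs).ne'
  have hT : ∀ s ∈ Set.Ioo m q, HasDerivAt T (ω s)⁻¹ s := fun s hs =>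
    intervalIntegral.integral_hasDerivAt_right
      (hinv.mono (Set.ordConnected_Ioo.uIcc_subset hc hs)).intervalIntegrable
      (hinv.stronglyMeasurableAtFilter isOpen_Ioo s hs) (hinv.continuousAt (isOpen_Ioo.mem_nhds hs))
  have hsurj := surjective_primitive_inv hω hmq hm hq hpos hT
  have hmono : StrictMonoOn T (Set.Ioo m q) := by
    refine strictMonoOn_of_deriv_pos (convex_Ioo m q)
      (fun s hs => (hT s hs).continuousAt.continuousWithinAt) ?_
    rw [interior_Ioo]
    intro s hs
    rw [(hT s hs).deriv]
    exact inv_pos.2 (hpos s hs)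
  set e : Set.Ioo m q ≃o ℝ := StrictMono.orderIsoOfSurjective (fun s : Set.Ioo m q => T s)
    (fun x y hxy => hmono x.2 y.2 hxy) (fun t => by
      obtain ⟨s, hs, h⟩ := hsurj (Set.mem_univ t)
      exact ⟨⟨s, hs⟩, h⟩)
  have he : ∀ t, T (e.symm t) = t := fun t => e.apply_symm_apply t
  refine ⟨fun t => e.symm t, fun t => ?_, ?_, ?_⟩
  · have hs := (e.symm t).2
    have hc : ContinuousAt (fun t => (e.symm t : ℝ)) t :=
      (continuous_subtype_val.comp e.symm.continuous).continuousAt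
    simpa using HasDerivAt.of_local_left_inverse hc (hT _ hs) (inv_ne_zero (hpos _ hs).ne')
      (Eventually.of_forall he)
  · have h1 : Tendsto (Subtype.val : Set.Ioo m q → ℝ) atBot (𝓝 m) :=
      (map_coe_Ioo_atBot hmq).le.trans nhdsWithin_le_nhds
    exact h1.comp e.symm.tendsto_atBot
  · have h1 : Tendsto (Subtype.val : Set.Ioo m q → ℝ) atTop (𝓝 q) :=
      (map_coe_Ioo_atTop hmq).le.trans nhdsWithin_le_nhds
    exact h1.comp e.symm.tendsto_atTop

/-- Existence of a heteroclinic orbit between two consecutive zeros of a vector field on `ℝ`. -/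
theorem exists_heteroclinic {ω : ℝ → ℝ} (hω : ContDiff ℝ 1 ω) {m q : ℝ} (hmq : m ≠ q)
    (hm : ω m = 0) (hq : ω q = 0)
    (hpos : ∀ t ∈ Set.Ioo (0 : ℝ) 1, 0 < (q - m) * ω (m + t * (q - m))) :
    ∃ h : ℝ → ℝ, (∀ t, HasDerivAt h (ω (h t)) t) ∧ Tendsto h atBot (𝓝 m) ∧
      Tendsto h atTop (𝓝 q) := by
  have hpos' : ∀ s, 0 < (s - m) / (q - m) → (s - m) / (q - m) < 1 → 0 < (q - m) * ω s := by
    intro s h0 h1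
    have := hpos _ ⟨h0, h1⟩
    rwa [div_mul_cancel₀ _ (sub_ne_zero.2 hmq.symm), add_sub_cancel] at this
  rcases hmq.lt_or_gt with hlt | hlt
  · have hd := sub_pos.2 hlt
    refine exists_heteroclinic_of_lt hω hlt hm hq fun s hs => ?_
    exact pos_of_mul_pos_right (hpos' s (div_pos (sub_pos.2 hs.1) hd)
      ((div_lt_one hd).2 (by linarith [hs.2]))) hd.le
  · have hd := sub_neg.2 hlt
    obtain ⟨h, h1, h2, h3⟩ := exists_heteroclinic_of_lt (ω := fun s => -ω (-s)) (m := -m) (q := -q)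
      (by fun_prop) (neg_lt_neg hlt) (by simp [hm]) (by simp [hq]) fun s hs => by
        have hs1 : -s - m < 0 := by linarith [hs.1]
        have := hpos' (-s) (div_pos_of_neg_of_neg hs1 hd)
          ((div_lt_one_of_neg hd).2 (by linarith [hs.2]))
        exact neg_pos.2 (neg_of_mul_pos_right this hd.le)
    refine ⟨fun t => -h t, fun t => ?_, by simpa using h2.neg, by simpa using h3.neg⟩
    exact (h1 t).fun_neg.congr_deriv (neg_neg _)

theorem integrable_deriv_of_nonneg {k k' : ℝ → ℝ} (hk : ∀ t, HasDerivAt k (k' t) t)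
    (hc : Continuous k') (h0 : ∀ t, 0 ≤ k' t) {m q : ℝ} (hm : Tendsto k atBot (𝓝 m))
    (hq : Tendsto k atTop (𝓝 q)) : Integrable k' := by
  have h_int : ∀ r : ℝ, ∫ x in (-r)..r, ‖k' x‖ = k r - k (-r) := fun r => by
    simp only [Real.norm_of_nonneg (h0 _)]
    exact intervalIntegral.integral_eq_sub_of_hasDerivAt (fun t _ => hk t)
      (hc.intervalIntegrable _ _)
  exact integrable_of_intervalIntegral_norm_tendsto (q - m)
    (fun r : ℝ => (hc.integrableOn_Icc (a := -r) (b := r)).mono_set Set.Ioc_subset_Icc_self)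
    tendsto_neg_atTop_atBot tendsto_id
    (by simpa only [id, h_int, Function.comp_apply] using hq.sub (hm.comp tendsto_neg_atTop_atBot))

/-- A heteroclinic solution of `h' = ω(h)` has energy equal to the increment of a primitive. -/
theorem lintegral_heteroclinic {ω Φ h : ℝ → ℝ} (hω : Continuous ω)
    (hΦ : ∀ s, HasDerivAt Φ (ω s) s) (hh : ∀ t, HasDerivAt h (ω (h t)) t) {m q : ℝ}
    (hm : Tendsto h atBot (𝓝 m)) (hq : Tendsto h atTop (𝓝 q)) :
    0 ≤ Φ q - Φ m ∧ ∫⁻ t, ENNReal.ofReal (1 / 2 * deriv h t ^ 2 + 1 / 2 * ω (h t) ^ 2)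
      = ENNReal.ofReal (Φ q - Φ m) := by
  have hΦc : Continuous Φ := continuous_iff_continuousAt.2 fun s => (hΦ s).continuousAt
  have hhc : Continuous h := continuous_iff_continuousAt.2 fun s => (hh s).continuousAt
  have e : ∀ t, 1 / 2 * deriv h t ^ 2 + 1 / 2 * ω (h t) ^ 2 = ω (h t) * ω (h t) := fun t => by
    rw [(hh t).deriv]; ring
  have hk : ∀ t, HasDerivAt (fun t => Φ (h t)) (ω (h t) * ω (h t)) t := fun t =>
    (hΦ (h t)).comp t (hh t)
  have hkm := (hΦc.tendsto m).comp hm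
  have hkq := (hΦc.tendsto q).comp hq
  have hi := integrable_deriv_of_nonneg hk (by fun_prop) (fun t => mul_self_nonneg _) hkm hkq
  have h_int := integral_of_hasDerivAt_of_tendsto hk hi hkm hkq
  refine ⟨h_int ▸ integral_nonneg fun t => mul_self_nonneg _, ?_⟩
  simp only [e]
  rw [← h_int, ofReal_integral_eq_lintegral_ofReal hi (.of_forall fun t => mul_self_nonneg _)]

/-- Modica--Mortola lower bound, with its equality case. -/
theorem lintegral_energy_lower_bound {ω Φ k : ℝ → ℝ} (hω : Continuous ω)
    (hΦ : ∀ s, HasDerivAt Φ (ω s) s) (hk : Differentiable ℝ k) {m q : ℝ}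
    (hm : Tendsto k atBot (𝓝 m)) (hq : Tendsto k atTop (𝓝 q)) (hA : 0 ≤ Φ q - Φ m) :
    ENNReal.ofReal (Φ q - Φ m)
        ≤ ∫⁻ t, ENNReal.ofReal (1 / 2 * deriv k t ^ 2 + 1 / 2 * ω (k t) ^ 2) ∧
      (∫⁻ t, ENNReal.ofReal (1 / 2 * deriv k t ^ 2 + 1 / 2 * ω (k t) ^ 2)
        ≤ ENNReal.ofReal (Φ q - Φ m) → ∀ t, HasDerivAt k (ω (k t)) t) := by
  set D : ℝ → ℝ := fun t => 1 / 2 * deriv k t ^ 2 + 1 / 2 * ω (k t) ^ 2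
  have hΦc : Continuous Φ := continuous_iff_continuousAt.2 fun s => (hΦ s).continuousAt
  have hkc := hk.continuous
  have hD0 : ∀ t, 0 ≤ D t := fun t => by positivity
  have hDm : Measurable D := by
    have := measurable_deriv k
    have : Measurable fun t => ω (k t) := (hω.comp hkc).measurable
    fun_prop
  have key : ∫⁻ t, ENNReal.ofReal (D t) ≠ ∞ → Integrable D ∧
      Integrable (fun t => ω (k t) * deriv k t) ∧ ∫ t, ω (k t) * deriv k t = Φ q - Φ m := by
    intro hfin
    have hDi : Integrable D := by
      refine ⟨hDm.aestronglyMeasurable, ?_⟩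
      rw [hasFiniteIntegral_iff_ofReal (.of_forall hD0)]
      exact lt_top_iff_ne_top.2 hfin
    have hi : Integrable (fun t => ω (k t) * deriv k t) := by
      refine hDi.mono (((hω.comp hkc).measurable.mul (measurable_deriv k)).aestronglyMeasurable)
        (.of_forall fun t => ?_)
      rw [Real.norm_of_nonneg (hD0 t), Real.norm_eq_abs, abs_le]
      constructor <;> simp only [D] <;> nlinarith [sq_nonneg (ω (k t) + deriv k t),
        sq_nonneg (ω (k t) - deriv k t)]
    exact ⟨hDi, hi, integral_of_hasDerivAt_of_tendsto
      (fun t => (hΦ (k t)).comp t (hk t).hasDerivAt) hi ((hΦc.tendsto m).comp hm)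
      ((hΦc.tendsto q).comp hq)⟩
  have hle : ∀ t, ω (k t) * deriv k t ≤ D t := fun t => by
    simp only [D]; nlinarith [sq_nonneg (ω (k t) - deriv k t)]
  constructor
  · by_cases hfin : ∫⁻ t, ENNReal.ofReal (D t) = ∞
    · rw [hfin]; exact le_top
    obtain ⟨hDi, hi, he⟩ := key hfin
    rw [← he, ← ofReal_integral_eq_lintegral_ofReal hDi (.of_forall hD0)]
    exact ENNReal.ofReal_le_ofReal (integral_mono hi hDi hle)
  · intro hup
    obtain ⟨hDi, hi, he⟩ := key (ne_top_of_le_ne_top ofReal_ne_top hup)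
    rw [← ofReal_integral_eq_lintegral_ofReal hDi (.of_forall hD0),
      ENNReal.ofReal_le_ofReal_iff hA, ← he] at hup
    have h0 : ∫ t, (D t - ω (k t) * deriv k t) = 0 :=
      le_antisymm (by rw [integral_sub hDi hi]; linarith)
        (integral_nonneg fun t => sub_nonneg.2 (hle t))
    rw [integral_eq_zero_iff_of_nonneg (fun t => sub_nonneg.2 (hle t)) (hDi.sub hi)] at h0
    refine hasDerivAt_of_ae_eq (fun t => (hk t).hasDerivAt) (by fun_prop) ?_
    filter_upwards [h0] with t ht
    simp only [D, Pi.zero_apply] at ht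
    nlinarith [sq_nonneg (ω (k t) - deriv k t)]

theorem exists_translate_of_hasDerivAt {ω g k : ℝ → ℝ} (hω : ContDiff ℝ 1 ω)
    (hg : ∀ t, HasDerivAt g (ω (g t)) t) (hk : ∀ t, HasDerivAt k (ω (k t)) t) {m q : ℝ}
    (hmq : m ≠ q) (hgm : Tendsto g atBot (𝓝 m)) (hgq : Tendsto g atTop (𝓝 q))
    (hkm : Tendsto k atBot (𝓝 m)) (hkq : Tendsto k atTop (𝓝 q)) :
    ∃ τ, ∀ t, k t = g (t + τ) := by
  have hgc : Continuous g := continuous_iff_continuousAt.2 fun s => (hg s).continuousAt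
  have hkc : Continuous k := continuous_iff_continuousAt.2 fun s => (hk s).continuousAt
  have hbd : ∀ φ : ℝ → ℝ, Continuous φ → Tendsto φ atBot (𝓝 m) → Tendsto φ atTop (𝓝 q) →
      (∃ M, ∀ t, |φ t| ≤ M) ∧ ∃ t, φ t = (m + q) / 2 := fun φ hφ h1 h2 => by
    constructor
    · obtain ⟨a, ha⟩ := eventually_atBot.1 (h1.abs.eventually (gt_mem_nhds (lt_add_one |m|)))
      obtain ⟨b, hb⟩ := eventually_atTop.1 (h2.abs.eventually (gt_mem_nhds (lt_add_one |q|)))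
      obtain ⟨M, hM⟩ := (isCompact_Icc (a := a) (b := b)).exists_bound_of_continuousOn
        hφ.continuousOn
      refine ⟨max M (max (|m| + 1) (|q| + 1)), fun t => ?_⟩
      rcases le_total t a with hta | hta
      · exact (ha t hta).le.trans ((le_max_left _ _).trans (le_max_right _ _))
      rcases le_total b t with hbt | hbt
      · exact (hb t hbt).le.trans ((le_max_right _ _).trans (le_max_right _ _))
      · exact (hM t ⟨hta, hbt⟩).trans (le_max_left _ _)
    · rcases hmq.lt_or_gt with hlt | hlt
      · exact mem_range_of_exists_le_of_exists_ge hφ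
          ((h1.eventually_le_const (by linarith : m < (m + q) / 2)).exists)
          ((h2.eventually_const_le (by linarith : (m + q) / 2 < q)).exists)
      · exact mem_range_of_exists_le_of_exists_ge hφ
          ((h2.eventually_le_const (by linarith : q < (m + q) / 2)).exists)
          ((h1.eventually_const_le (by linarith : (m + q) / 2 < m)).exists)
  obtain ⟨⟨M₁, hM₁⟩, t₁, ht₁⟩ := hbd g hgc hgm hgq
  obtain ⟨⟨M₂, hM₂⟩, t₂, ht₂⟩ := hbd k hkc hkm hkq
  obtain ⟨K, hK⟩ := (hω.contDiffOn (s := Set.Icc (-max M₁ M₂) (max M₁ M₂))).exists_lipschitzOnWith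
    one_ne_zero (convex_Icc _ _) isCompact_Icc
  refine ⟨t₁ - t₂, fun t => congrFun (ODE_solution_unique_univ (v := fun _ => ω)
    (g := fun t => g (t + (t₁ - t₂))) (t₀ := t₂) (fun _ => hK)
    (fun t => ⟨hk t, abs_le.1 ((hM₂ t).trans (le_max_right _ _))⟩)
    (fun t => ⟨(hg _).comp_add_const t _, abs_le.1 ((hM₁ _).trans (le_max_left _ _))⟩) ?_) t⟩
  rw [ht₂, add_sub_cancel, ht₁]

theorem memLp_of_lintegral_sq_ne_top {D : ℝ × ℝ → ℝ} (hm : Measurable D)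
    (h : ∫⁻ z, ENNReal.ofReal (D z ^ 2) ∂(volume : Measure ℝ).prod cellMeasure ≠ ∞) (s t : ℝ) :
    MemLp D 2 (boxMeasure s t) := by
  refine MemLp.mono_measure (boxMeasure_le_strip s t) ?_
  rw [memLp_two_iff_integrable_sq hm.aestronglyMeasurable]
  refine ⟨(hm.pow_const 2).aestronglyMeasurable, ?_⟩
  rw [hasFiniteIntegral_iff_ofReal (.of_forall fun z => sq_nonneg _)]
  exact lt_top_iff_ne_top.2 h

theorem differentiable_partials {w : ℝ × ℝ → ℝ} (hw : ContDiff ℝ 2 w) :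
    Differentiable ℝ (dx w) ∧ Differentiable ℝ (dy w) := by
  have h : Differentiable ℝ (fderiv ℝ w) :=
    (hw.fderiv_right (m := 1) (by norm_num)).differentiable one_ne_zero
  exact ⟨fun z => (h z).clm_apply (differentiableAt_const _),
    fun z => (h z).clm_apply (differentiableAt_const _)⟩

/-- A divergence-free periodic field whose energy is at most the one-dimensional one is
one-dimensional, and its profile solves a first order equation. -/
theorem exists_profile_of_energy_le {w f g : ℝ × ℝ → ℝ} (hw : ContDiff ℝ 2 w) {ε : ℝ}
    (hε : ε = 1 ∨ ε = -1) (hwe : ∀ z, dx (dx w) z = ε * dy (dy w) z) (hf : Differentiable ℝ f)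
    (hg : Differentiable ℝ g) (hpf : PeriodicSnd f) (hpg : PeriodicSnd g)
    (hdiv : ∀ z, dy g z = -dx f z) {p qm qp : ℝ}
    (hfm : Tendsto (fun x => ∫ y, f (x, y) ∂cellMeasure) atBot (𝓝 p))
    (hgm : Tendsto (fun x => ∫ y, g (x, y) ∂cellMeasure) atBot (𝓝 qm))
    (hfp : Tendsto (fun x => ∫ y, f (x, y) ∂cellMeasure) atTop (𝓝 p))
    (hgp : Tendsto (fun x => ∫ y, g (x, y) ∂cellMeasure) atTop (𝓝 qp))
    {Φ : ℝ → ℝ} (hΦ : ∀ s, HasDerivAt Φ (w (p, s)) s) (hA : 0 ≤ Φ qp - Φ qm)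
    (hE : ∫⁻ z, ENNReal.ofReal (fieldDensity w f g z) ∂(volume : Measure ℝ).prod cellMeasure
      ≤ ENNReal.ofReal (Φ qp - Φ qm)) :
    ∃ γ : ℝ → ℝ, (∀ z, f z = p ∧ g z = γ z.1) ∧ ∀ t, HasDerivAt γ (w (p, γ t)) t := by
  have hwd := hw.differentiable two_ne_zero
  obtain ⟨hwx, hwy⟩ := differentiable_partials hw
  obtain ⟨α, Φ₀, Φ₁, hα, h0, h1, h0x, h0y, h1x, h1y⟩ := exists_calibration hwd hwx hwy hwe
  have hfin := ne_top_of_le_ne_top ofReal_ne_top hE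
  have hnn : ∀ z, 0 ≤ fieldDensity w f g z := fun z => by unfold fieldDensity; positivity
  have hdom : ∀ D : ℝ × ℝ → ℝ, (∀ z, D z ≤ 2 * fieldDensity w f g z) →
      ∫⁻ z, ENNReal.ofReal (D z) ∂(volume : Measure ℝ).prod cellMeasure ≠ ∞ := fun D hD => by
    refine ne_top_of_le_ne_top (ENNReal.mul_ne_top ofNat_ne_top hfin) (b := 2 * _) ?_
    rw [← lintegral_const_mul' _ _ ofNat_ne_top]
    refine lintegral_mono fun z => (ENNReal.ofReal_le_ofReal (hD z)).trans_eq ?_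
    rw [ENNReal.ofReal_mul two_pos.le, ENNReal.ofReal_ofNat]
  have hsq : ∀ z, dx f z ^ 2 ≤ 2 * fieldDensity w f g z ∧ dy f z ^ 2 ≤ 2 * fieldDensity w f g z ∧
      dx g z ^ 2 ≤ 2 * fieldDensity w f g z ∧ dy g z ^ 2 ≤ 2 * fieldDensity w f g z ∧
      dy f z ^ 2 + dy g z ^ 2 ≤ 2 * fieldDensity w f g z := fun z => by
    have := sq_nonneg (dx f z)
    have := sq_nonneg (dy f z)
    have := sq_nonneg (dx g z)
    have := sq_nonneg (dy g z)
    have := sq_nonneg (w (f z, g z))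
    unfold fieldDensity
    refine ⟨?_, ?_, ?_, ?_, ?_⟩ <;> linarith
  have Hf : PeriodicSobolev f := ⟨hf, hpf,
    memLp_of_lintegral_sq_ne_top (measurable_dx f) (hdom _ fun z => (hsq z).1),
    memLp_of_lintegral_sq_ne_top (measurable_dy f) (hdom _ fun z => (hsq z).2.1)⟩
  have Hg : PeriodicSobolev g := ⟨hg, hpg,
    memLp_of_lintegral_sq_ne_top (measurable_dx g) (hdom _ fun z => (hsq z).2.2.1),
    memLp_of_lintegral_sq_ne_top (measurable_dy g) (hdom _ fun z => (hsq z).2.2.2.1)⟩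
  have hgs := hdom _ fun z => (hsq z).2.2.2.2
  have hbot : ∀ δ > 0, ∃ᶠ x in atBot, GoodSlice f g p qm δ x := fun δ hδ =>
    frequently_goodSlice hf hg hpf hpg hgs (fun S => volume_eq_top_of_mem_atBot) hfm hgm hδ
  have htop : ∀ δ > 0, ∃ᶠ x in atTop, GoodSlice f g p qp δ x := fun δ hδ =>
    frequently_goodSlice hf hg hpf hpg hgs (fun S => volume_eq_top_of_mem_atTop) hfp hgp hδ
  have hinc : Φ qp - Φ qm = Φ₀ (p, qp) - Φ₀ (p, qm) := by
    have hc : Continuous fun s => w (p, s) := by have := hw.continuous; fun_prop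
    have hi := hc.intervalIntegrable (μ := volume) qm qp
    rw [← intervalIntegral.integral_eq_sub_of_hasDerivAt (fun s _ => hΦ s) hi,
      ← intervalIntegral.integral_eq_sub_of_hasDerivAt (f := fun s => Φ₀ (p, s))
        (fun s _ => by simpa only [h0y] using hasDerivAt_slice_snd h0 p s) hi]
  have hE' : ∀ s t, ∫ z, fieldDensity w f g z ∂boxMeasure s t ≤ Φ₀ (p, qp) - Φ₀ (p, qm) :=
    fun s t => by
      rw [← hinc]
      have hm : Measurable (fieldDensity w f g) := by
        have := measurable_dx f
        have := measurable_dy f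
        have := measurable_dx g
        have := measurable_dy g
        have := hw.continuous.measurable
        have := hf.continuous.measurable
        have := hg.continuous.measurable
        unfold fieldDensity
        fun_prop
      rw [integral_eq_lintegral_of_nonneg_ae (.of_forall hnn) hm.aestronglyMeasurable]
      exact ENNReal.toReal_le_of_le_ofReal hA
        ((lintegral_mono' (boxMeasure_le_strip s t) le_rfl).trans hE)
  refine exists_profile Hf Hg hdiv hwd hwx.continuous hwy.continuous hε hbot htop ?_
  refine calibrationDefect_ae_eq_zero Hf Hg hdiv hw.continuous ?_ hα.continuous h0 h1 h0x h0y
    h1x h1y hbot htop hE'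
  rcases hε with rfl | rfl <;> norm_num

/-- The identification of `ℝ × ℝ` with `ℝ²`. -/
def plane : ℝ × ℝ →L[ℝ] Fin 2 → ℝ :=
  ContinuousLinearMap.pi ![ContinuousLinearMap.fst ℝ ℝ ℝ, ContinuousLinearMap.snd ℝ ℝ ℝ]

@[simp] theorem plane_zero (z : ℝ × ℝ) : plane z 0 = z.1 := rfl

@[simp] theorem plane_one (z : ℝ × ℝ) : plane z 1 = z.2 := rfl

theorem plane_mk (x : Fin 2 → ℝ) : plane (x 0, x 1) = x := by
  ext i; fin_cases i <;> rfl

theorem plane_one_zero : plane (1, 0) = Pi.single 0 1 := by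
  ext i; fin_cases i <;> simp

theorem plane_zero_one : plane (0, 1) = Pi.single 1 1 := by
  ext i; fin_cases i <;> simp

theorem dx_comp_plane {w : (Fin 2 → ℝ) → ℝ} (hw : Differentiable ℝ w) :
    dx (fun z => w (plane z)) = fun z => pdS 0 w (plane z) := by
  funext z
  have := ((hw (plane z)).hasFDerivAt.comp z plane.hasFDerivAt).fderiv
  rw [dx, pdS, ← plane_one_zero]
  exact congrArg (fun L => L (1, 0)) this

theorem dy_comp_plane {w : (Fin 2 → ℝ) → ℝ} (hw : Differentiable ℝ w) :
    dy (fun z => w (plane z)) = fun z => pdS 1 w (plane z) := by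
  funext z
  have := ((hw (plane z)).hasFDerivAt.comp z plane.hasFDerivAt).fderiv
  rw [dy, pdS, ← plane_zero_one]
  exact congrArg (fun L => L (0, 1)) this

theorem pdS_apply {u : (Fin 2 → ℝ) → Fin 2 → ℝ} (hu : Differentiable ℝ u) (i j : Fin 2)
    (x : Fin 2 → ℝ) : pdS i (fun x => u x j) x = pd i u x j := by
  rw [pdS, pd, fderiv_apply (hu x)]
  rfl

theorem differentiable_pdS {w : (Fin 2 → ℝ) → ℝ} (hw : ContDiff ℝ 2 w) (i : Fin 2) :
    Differentiable ℝ (pdS i w) := fun z =>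
  ((hw.fderiv_right (m := 1) (by norm_num)).differentiable one_ne_zero z).clm_apply
    (differentiableAt_const _)

theorem periodicSnd_comp_plane {u : (Fin 2 → ℝ) → Fin 2 → ℝ} (hu : IsPeriodic u) (j : Fin 2) :
    PeriodicSnd fun z => u (plane z) j := fun x y => by
  have h : plane (x, y + 1) = plane (x, y) + Pi.single 1 1 := by
    rw [← plane_zero_one, ← map_add]; simp
  simp only [h, hu (plane (x, y)) 1 one_ne_zero]

theorem coe_plane : ⇑plane = (MeasurableEquiv.finTwoArrow (α := ℝ)).symm := by
  funext z i
  fin_cases i <;> rfl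

theorem measurePreserving_plane : MeasurePreserving plane volume volume :=
  coe_plane ▸ (volume_preserving_finTwoArrow ℝ).symm

theorem measurableEmbedding_plane : MeasurableEmbedding plane :=
  coe_plane ▸ (MeasurableEquiv.finTwoArrow (α := ℝ)).symm.measurableEmbedding

theorem restrict_Ico_eq_cellMeasure :
    (volume : Measure ℝ).restrict (Set.Ico 0 1) = cellMeasure :=
  Measure.restrict_congr_set Ico_ae_eq_Ioc

theorem lintegral_strip (F : (Fin 2 → ℝ) → ℝ≥0∞) :
    ∫⁻ x in strip 2, F x = ∫⁻ z, F (plane z) ∂(volume : Measure ℝ).prod cellMeasure := by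
  rw [← measurePreserving_plane.setLIntegral_comp_preimage_emb measurableEmbedding_plane]
  have h : plane ⁻¹' strip 2 = Set.univ ×ˢ Set.Ico (0 : ℝ) 1 := by
    ext z
    simp [strip, Fin.forall_fin_two]
  rw [h, Measure.volume_eq_prod, ← Measure.prod_restrict, Measure.restrict_univ,
    restrict_Ico_eq_cellMeasure]

theorem avg_eq {u : (Fin 2 → ℝ) → Fin 2 → ℝ} (hu : Continuous u) (t : ℝ) (j : Fin 2) :
    avg u t j = ∫ y, u (plane (t, y)) j ∂cellMeasure := by
  have h : plane ⁻¹' cube 2 = Set.Ico (0 : ℝ) 1 ×ˢ Set.Ico (0 : ℝ) 1 := by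
    ext z
    simp [cube, Fin.forall_fin_two]
  have h1 : ∀ z : ℝ × ℝ, Function.update (plane z) 0 t = plane (t, z.2) := fun z => by
    ext i; fin_cases i <;> simp
  have h2 : avg u t = ∫ y, u (plane (t, y)) ∂cellMeasure := by
    rw [avg, ← measurePreserving_plane.setIntegral_preimage_emb measurableEmbedding_plane, h,
      Measure.volume_eq_prod, ← Measure.prod_restrict, restrict_Ico_eq_cellMeasure]
    simp only [h1]
    rw [integral_fun_snd (f := fun y => u (plane (t, y)))]
    simp
  rw [h2, eval_integral]
  intro i
  have hc : Continuous fun y => u (plane (t, y)) i := by fun_prop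
  exact (hc.integrableOn_Icc (a := 0) (b := 1)).mono_set Set.Ioc_subset_Icc_self

theorem gradSq_plane {u : (Fin 2 → ℝ) → Fin 2 → ℝ} (hu : Differentiable ℝ u) (z : ℝ × ℝ) :
    gradSq u (plane z) = dx (fun z => u (plane z) 0) z ^ 2 + dy (fun z => u (plane z) 0) z ^ 2
      + dx (fun z => u (plane z) 1) z ^ 2 + dy (fun z => u (plane z) 1) z ^ 2 := by
  have hj : ∀ j, Differentiable ℝ fun x => u x j := fun j => by fun_prop
  rw [dx_comp_plane (hj 0), dx_comp_plane (hj 1), dy_comp_plane (hj 0), dy_comp_plane (hj 1)]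
  simp only [pdS_apply hu, gradSq, Fin.sum_univ_two]
  ring

theorem energy_eq {W w : (Fin 2 → ℝ) → ℝ} (hW : ∀ z, W z = 1 / 2 * w z ^ 2)
    {u : (Fin 2 → ℝ) → Fin 2 → ℝ} (hu : Differentiable ℝ u) :
    energy 2 W u = ∫⁻ z, ENNReal.ofReal (fieldDensity (fun z => w (plane z))
      (fun z => u (plane z) 0) (fun z => u (plane z) 1) z) ∂(volume : Measure ℝ).prod cellMeasure := by
  rw [energy, lintegral_strip]
  refine lintegral_congr fun z => ?_
  rw [eden, gradSq_plane hu, hW, fieldDensity, plane_mk (u (plane z))]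

/-- The one-dimensional field with profile `h` in the line `{z₁ = a}`. -/
def layer (a : ℝ) (h : ℝ → ℝ) (x : Fin 2 → ℝ) : Fin 2 → ℝ := ![a, h (x 0)]

theorem differentiable_layer (a : ℝ) {h : ℝ → ℝ} (hh : Differentiable ℝ h) :
    Differentiable ℝ (layer a h) := by
  refine differentiable_pi.2 fun i => ?_
  fin_cases i
  · exact differentiable_const a
  · exact hh.comp (differentiable_apply 0)

theorem layer_partials (a : ℝ) {h : ℝ → ℝ} (hh : Differentiable ℝ h) (z : ℝ × ℝ) :
    dx (fun z => layer a h (plane z) 0) z = 0 ∧ dy (fun z => layer a h (plane z) 0) z = 0 ∧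
      dx (fun z => layer a h (plane z) 1) z = deriv h z.1 ∧
      dy (fun z => layer a h (plane z) 1) z = 0 := by
  have h1 : HasFDerivAt (fun z : ℝ × ℝ => layer a h (plane z) 1)
      (deriv h z.1 • ContinuousLinearMap.fst ℝ ℝ ℝ) z :=
    (hh z.1).hasDerivAt.comp_hasFDerivAt z hasFDerivAt_fst
  have h0 : (fun z : ℝ × ℝ => layer a h (plane z) 0) = fun _ => a := rfl
  refine ⟨?_, ?_, ?_, ?_⟩
  · rw [h0]; simp [dx]
  · rw [h0]; simp [dy]
  · rw [dx, h1.fderiv]; simp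
  · rw [dy, h1.fderiv]; simp

theorem lintegral_strip_fst {F : ℝ → ℝ≥0∞} (hF : Measurable F) :
    ∫⁻ z, F z.1 ∂(volume : Measure ℝ).prod cellMeasure = ∫⁻ t, F t := by
  rw [lintegral_prod _ (by fun_prop)]
  simp

theorem energy_layer {W w : (Fin 2 → ℝ) → ℝ} (hW : ∀ z, W z = 1 / 2 * w z ^ 2)
    (hw : Continuous w) (a : ℝ) {h : ℝ → ℝ} (hh : Differentiable ℝ h) :
    energy 2 W (layer a h)
      = ∫⁻ t, ENNReal.ofReal (1 / 2 * deriv h t ^ 2 + 1 / 2 * w (plane (a, h t)) ^ 2) := by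
  rw [energy_eq hW (differentiable_layer a hh)]
  have hhc := hh.continuous
  have : Continuous fun t => w (plane (a, h t)) := by fun_prop
  have := this.measurable
  have := measurable_deriv h
  rw [← lintegral_strip_fst (by fun_prop)]
  refine lintegral_congr fun z => ?_
  obtain ⟨h1, h2, h3, h4⟩ := layer_partials a hh z
  rw [fieldDensity, h1, h2, h3, h4]
  congr 1
  simp [layer]

theorem adm_layer (a : ℝ) {h : ℝ → ℝ} (hh : Differentiable ℝ h)
    (hfin : ∫⁻ t, ENNReal.ofReal (deriv h t ^ 2) ≠ ∞) : Adm 2 (layer a h) := by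
  have hd := differentiable_layer a hh
  have hj : ∀ j, Differentiable ℝ fun x => layer a h x j := fun j => by fun_prop
  have hgr : gradSq (layer a h) = fun x => deriv h (x 0) ^ 2 := by
    funext x
    obtain ⟨h1, h2, h3, h4⟩ := layer_partials a hh (x 0, x 1)
    rw [← plane_mk x, gradSq_plane hd, h1, h2, h3, h4]
    simp
  have hm := measurable_deriv h
  refine ⟨hd, fun x i hi => ?_, fun x => ?_, ?_⟩
  · simp [layer, hi.symm]
  · obtain ⟨h1, h2, h3, h4⟩ := layer_partials a hh (x 0, x 1)
    rw [dx_comp_plane (hj 0)] at h1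
    rw [dy_comp_plane (hj 1)] at h4
    simp only [pdS_apply hd, plane_mk] at h1 h4
    rw [Fin.sum_univ_two, h1, h4, add_zero]
  · rw [hgr]
    refine ⟨Measurable.aestronglyMeasurable (by fun_prop), ?_⟩
    rw [hasFiniteIntegral_iff_ofReal (.of_forall fun x => sq_nonneg _),
      lintegral_strip fun x => ENNReal.ofReal (deriv h (x 0) ^ 2)]
    simp only [plane_zero]
    rw [lintegral_strip_fst (F := fun t => ENNReal.ofReal (deriv h t ^ 2)) (by fun_prop)]
    exact lt_top_iff_ne_top.2 hfin

theorem tendsto_plane {l : Filter ℝ} {γ : ℝ → Fin 2 → ℝ} {b : Fin 2 → ℝ}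
    (h0 : Tendsto (fun t => γ t 0) l (𝓝 (b 0))) (h1 : Tendsto (fun t => γ t 1) l (𝓝 (b 1))) :
    Tendsto γ l (𝓝 b) :=
  tendsto_pi_nhds.2 (Fin.forall_fin_two.2 ⟨h0, h1⟩)

theorem bdryCond_layer {a : ℝ} {h : ℝ → ℝ} (hh : Differentiable ℝ h) {um up : Fin 2 → ℝ}
    (hum : um 0 = a) (hup : up 0 = a) (hm : Tendsto h atBot (𝓝 (um 1)))
    (hp : Tendsto h atTop (𝓝 (up 1))) : BdryCond 2 (layer a h) um up := by
  have hc := (differentiable_layer a hh).continuous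
  have e0 : (fun t => avg (layer a h) t 0) = fun _ => a := by
    funext t; rw [avg_eq hc]; simp [layer]
  have e1 : (fun t => avg (layer a h) t 1) = h := by
    funext t; rw [avg_eq hc]; simp [layer]
  constructor
  · exact tendsto_plane (by rw [e0, hum]; exact tendsto_const_nhds) (by rwa [e1])
  · exact tendsto_plane (by rw [e0, hup]; exact tendsto_const_nhds) (by rwa [e1])

theorem energy1D_eq {W w : (Fin 2 → ℝ) → ℝ} (hW : ∀ z, W z = 1 / 2 * w z ^ 2) {a : ℝ}
    {γ : ℝ → Fin 2 → ℝ} (hγ : Differentiable ℝ γ) (h0 : ∀ t, γ t 0 = a) :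
    energy1D 2 W γ = ∫⁻ t, ENNReal.ofReal
      (1 / 2 * deriv (fun t => γ t 1) t ^ 2 + 1 / 2 * w (plane (a, γ t 1)) ^ 2) := by
  refine lintegral_congr fun t => ?_
  have hd : ∀ i, deriv γ t i = deriv (fun t => γ t i) t := fun i =>
    congrFun (deriv_pi fun i => (differentiable_pi.1 hγ i) t) i
  rw [hW, vnorm2, Fin.sum_univ_two, hd, hd]
  have e : (fun t => γ t 0) = fun _ => a := funext h0
  rw [e, ← h0 t, plane_mk]
  simp

/-- The wave equation (`ε = 1`) and the Laplace equation (`ε = -1`) in planar coordinates. -/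
theorem partials_comp_plane {w : (Fin 2 → ℝ) → ℝ} (hw : ContDiff ℝ 2 w) {ε : ℝ}
    (h : ∀ z, pdS 0 (pdS 0 w) z = ε * pdS 1 (pdS 1 w) z) (σ : ℝ) (z : ℝ × ℝ) :
    dx (dx fun z => σ * w (plane z)) z = ε * dy (dy fun z => σ * w (plane z)) z := by
  have hmul : ∀ {F : ℝ × ℝ → ℝ}, Differentiable ℝ F →
      (dx fun z => σ * F z) = (fun z => σ * dx F z) ∧
      (dy fun z => σ * F z) = fun z => σ * dy F z := fun {F} hF =>
    ⟨funext fun z => by rw [dx, ((hF z).hasFDerivAt.const_mul σ).fderiv]; rfl,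
      funext fun z => by rw [dy, ((hF z).hasFDerivAt.const_mul σ).fderiv]; rfl⟩
  have hwd := hw.differentiable two_ne_zero
  have h0 := differentiable_pdS hw 0
  have h1 := differentiable_pdS hw 1
  have hc : ∀ {F : (Fin 2 → ℝ) → ℝ}, Differentiable ℝ F → Differentiable ℝ fun z => F (plane z) :=
    fun hF => hF.comp plane.differentiable
  rw [(hmul (hc hwd)).1, (hmul (hc hwd)).2, dx_comp_plane hwd, dy_comp_plane hwd,
    (hmul (hc h0)).1, (hmul (hc h1)).2, dx_comp_plane h0, dy_comp_plane h1]
  simp only [h]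
  ring

/-- Theorem `thm:harm_wave`: in dimension `d = 2`, for `W = ½w²` with `w`
harmonic (resp. a solution of the wave equation) and `w > 0` on the open segment `(u⁻,u⁺)`,
every global minimizer of `(P)` (bounded, or with `W` of at most Gaussian-exponential growth)
is one-dimensional: `u(x) = g(x₁)` where `g` is the unique (up to translation) minimizer of
the one-dimensional problem. -/
theorem statement5
    (w : (Fin 2 → ℝ) → ℝ) (hw : ContDiff ℝ 2 w)
    (heq : (∀ z, pdS 0 (pdS 0 w) z + pdS 1 (pdS 1 w) z = 0) ∨
           (∀ z, pdS 0 (pdS 0 w) z - pdS 1 (pdS 1 w) z = 0))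
    (W : (Fin 2 → ℝ) → ℝ) (hW : ∀ z, W z = (1 / 2) * w z ^ 2)
    (a : ℝ) (um up : Fin 2 → ℝ) (hum : um 0 = a) (hup : up 0 = a) (hne : um ≠ up)
    (hWm : W um = 0) (hWp : W up = 0)
    (hwpos : ∀ t : ℝ, t ∈ Set.Ioo (0 : ℝ) 1 → 0 < w (um + t • (up - um)))
    (u : (Fin 2 → ℝ) → Fin 2 → ℝ)
    (hadm : Adm 2 u) (hbc : BdryCond 2 u um up)
    (hmin : ∀ v, Adm 2 v → BdryCond 2 v um up → energy 2 W u ≤ energy 2 W v)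
    (hside : (∃ M, ∀ x, ‖u x‖ ≤ M) ∨
      (∃ C > (0 : ℝ), ∃ β > (0 : ℝ), ∀ z, W z ≤ C * Real.exp (β * vnorm2 z))) :
    ∃ g : ℝ → Fin 2 → ℝ,
      (∀ x, u x = g (x 0)) ∧
      Adm1D 2 a um up g ∧
      (∀ γ, Adm1D 2 a um up γ → energy1D 2 W g ≤ energy1D 2 W γ) ∧
      (∀ γ, Adm1D 2 a um up γ →
        (∀ γ', Adm1D 2 a um up γ' → energy1D 2 W γ ≤ energy1D 2 W γ') →
        ∃ τ : ℝ, ∀ t, γ t = g (t + τ)) := by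
  obtain ⟨ε, hε, hwε⟩ : ∃ ε : ℝ, (ε = 1 ∨ ε = -1) ∧
      ∀ z, pdS 0 (pdS 0 w) z = ε * pdS 1 (pdS 1 w) z := by
    rcases heq with h | h
    · exact ⟨-1, .inr rfl, fun z => by linarith [h z]⟩
    · exact ⟨1, .inl rfl, fun z => by linarith [h z]⟩
  have hne1 : um 1 ≠ up 1 := fun h =>
    hne (funext (Fin.forall_fin_two.2 ⟨hum.trans hup.symm, h⟩))
  obtain ⟨σ, hσ, hσpos⟩ : ∃ σ : ℝ, σ ^ 2 = 1 ∧ 0 < (up 1 - um 1) * σ := by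
    rcases hne1.lt_or_gt with h | h
    · exact ⟨1, by norm_num, by linarith⟩
    · exact ⟨-1, by norm_num, by linarith⟩
  set w' : (Fin 2 → ℝ) → ℝ := fun z => σ * w z with hw'
  have hW' : ∀ z, W z = 1 / 2 * w' z ^ 2 := fun z => by rw [hW, hw', mul_pow, hσ, one_mul]
  have hw'c : ContDiff ℝ 2 w' := contDiff_const.mul hw
  have hwp : ContDiff ℝ 2 fun z => w' (plane z) := hw'c.comp plane.contDiff
  set ω : ℝ → ℝ := fun s => w' (plane (a, s)) with hωdef
  have hω : ContDiff ℝ 1 ω :=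
    (hwp.comp (contDiff_const.prodMk contDiff_id)).of_le (by norm_num)
  have hzero : ∀ z : Fin 2 → ℝ, z 0 = a → W z = 0 → ω (z 1) = 0 := fun z h0 hz => by
    rw [hωdef, ← h0]
    simp only [plane_mk]
    rw [hW'] at hz
    simpa using hz
  have hωpos : ∀ t ∈ Set.Ioo (0 : ℝ) 1,
      0 < (up 1 - um 1) * ω (um 1 + t * (up 1 - um 1)) := fun t ht => by
    have e : plane (a, um 1 + t * (up 1 - um 1)) = um + t • (up - um) := by
      ext i; fin_cases i <;> simp [hum, hup]
    rw [hωdef]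
    simp only [e, hw', ← mul_assoc]
    exact mul_pos hσpos (hwpos t ht)
  obtain ⟨h, hh, hhm, hhp⟩ := exists_heteroclinic hω hne1 (hzero um hum hWm) (hzero up hup hWp) hωpos
  obtain ⟨Φ, hΦ⟩ : ∃ Φ : ℝ → ℝ, ∀ s, HasDerivAt Φ (ω s) s :=
    ⟨_, fun s => (hω.continuous.integral_hasStrictDerivAt 0 s).hasDerivAt⟩
  obtain ⟨hA, hhE⟩ := lintegral_heteroclinic hω.continuous hΦ hh hhm hhp
  have hhd : Differentiable ℝ h := fun t => (hh t).differentiableAt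
  have hE : energy 2 W u ≤ ENNReal.ofReal (Φ (up 1) - Φ (um 1)) := by
    rw [← hhE, ← energy_layer hW' hw'c.continuous a hhd]
    refine hmin _ (adm_layer a hhd ?_) (bdryCond_layer hhd hum hup hhm hhp)
    refine ne_top_of_le_ne_top (ENNReal.mul_ne_top ofNat_ne_top (hhE.trans_ne ofReal_ne_top))
      (b := 2 * _) ?_
    rw [← lintegral_const_mul' _ _ ofNat_ne_top]
    refine lintegral_mono fun t => ?_
    rw [← ENNReal.ofReal_ofNat, ← ENNReal.ofReal_mul (by norm_num)]
    exact ENNReal.ofReal_le_ofReal (by linarith [sq_nonneg (ω (h t))])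
  obtain ⟨hud, huper, hudiv, -⟩ := hadm
  have huj : ∀ j, Differentiable ℝ fun x => u x j := fun j => by fun_prop
  have hup' : ∀ j, Differentiable ℝ fun z => u (plane z) j := fun j =>
    (huj j).comp plane.differentiable
  have hbc' : ∀ {l : Filter ℝ} {b : Fin 2 → ℝ}, Tendsto (avg u) l (𝓝 b) → ∀ j,
      Tendsto (fun x => ∫ y, u (plane (x, y)) j ∂cellMeasure) l (𝓝 (b j)) := fun hl j => by
    simpa only [avg_eq hud.continuous] using tendsto_pi_nhds.1 hl j
  have hdiv' : ∀ z, dy (fun z => u (plane z) 1) z = -dx (fun z => u (plane z) 0) z := fun z => by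
    have := hudiv (plane z)
    rw [Fin.sum_univ_two] at this
    rw [dx_comp_plane (huj 0), dy_comp_plane (huj 1)]
    simp only [pdS_apply hud]
    linarith
  obtain ⟨γ, hγ, hγd⟩ := exists_profile_of_energy_le hwp hε (partials_comp_plane hw hwε σ)
    (hup' 0) (hup' 1) (periodicSnd_comp_plane huper 0) (periodicSnd_comp_plane huper 1) hdiv'
    (hum ▸ hbc' hbc.1 0) (hbc' hbc.1 1) (hup ▸ hbc' hbc.2 0) (hbc' hbc.2 1) hΦ hA
    ((energy_eq hW' hud).symm.trans_le hE)
  have hγc : Differentiable ℝ γ := fun t => (hγd t).differentiableAt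
  have hγm : Tendsto γ atBot (𝓝 (um 1)) := by simpa [hγ] using hbc' hbc.1 1
  have hγp : Tendsto γ atTop (𝓝 (up 1)) := by simpa [hγ] using hbc' hbc.2 1
  have hγE := (lintegral_heteroclinic hω.continuous hΦ hγd hγm hγp).2
  set g : ℝ → Fin 2 → ℝ := fun t => ![a, γ t] with hg
  have hgd : Differentiable ℝ g :=
    differentiable_pi.2 (Fin.forall_fin_two.2 ⟨differentiable_const a, hγc⟩)
  have hgadm : Adm1D 2 a um up g :=
    ⟨hgd, fun _ => rfl, tendsto_plane (hum ▸ tendsto_const_nhds) hγm,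
      tendsto_plane (hup ▸ tendsto_const_nhds) hγp⟩
  have hgE : energy1D 2 W g = ENNReal.ofReal (Φ (up 1) - Φ (um 1)) := by
    rw [← hγE, energy1D_eq hW' hgd fun _ => rfl]
    rfl
  have hlow : ∀ κ, Adm1D 2 a um up κ → energy1D 2 W g ≤ energy1D 2 W κ ∧
      (energy1D 2 W κ ≤ energy1D 2 W g → ∀ t, HasDerivAt (fun t => κ t 1) (ω (κ t 1)) t) := by
    rintro κ ⟨hκ, h0, hκm, hκp⟩
    rw [hgE, energy1D_eq hW' hκ h0]
    exact lintegral_energy_lower_bound hω.continuous hΦ (differentiable_pi.1 hκ 1)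
      (tendsto_pi_nhds.1 hκm 1) (tendsto_pi_nhds.1 hκp 1) hA
  refine ⟨g, fun x => ?_, hgadm, fun κ hκ => (hlow κ hκ).1, fun κ hκ hκmin => ?_⟩
  · have := hγ (x 0, x 1)
    rw [plane_mk] at this
    exact funext (Fin.forall_fin_two.2 this)
  · obtain ⟨τ, hτ⟩ := exists_translate_of_hasDerivAt hω hγd ((hlow κ hκ).2 (hκmin g hgadm)) hne1
      hγm hγp (tendsto_pi_nhds.1 hκ.2.2.1 1) (tendsto_pi_nhds.1 hκ.2.2.2 1)
    exact ⟨τ, fun t => funext (Fin.forall_fin_two.2 ⟨hκ.2.1 t, hτ t⟩)⟩
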